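/- arXiv:2511.14885 — 5 statements merged into one kernel-verified Lean document; each statement's English description precedes it below -/
import Mathlib

section
/- Let n ≥ 2 and s ∈ (0,1). There exists a constant C₀ > 0, depending only on n and s, such that for every measurable set E ⊂ ℝⁿ with 0 < |E| < ∞ one has ζ_s(E) ≥ C₀ α(E)². -/
open MeasureTheory Metric Set Filter
open scoped ENNReal NNReal symmDiff Topology

noncomputable section

/-- The ambient Euclidean space `ℝⁿ`. -/
abbrev Rn (n : ℕ) := EuclideanSpace ℝ (Fin n)

/-- The fractional `s`-perimeter `P_s(E) = ∫_E ∫_{Eᶜ} |x-y|^{-(n+s)} dx dy`. -/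
def fracPer (n : ℕ) (s : ℝ) (E : Set (Rn n)) : ℝ≥0∞ :=
  ∫⁻ x in E, ∫⁻ y in Eᶜ, ENNReal.ofReal (‖x - y‖ ^ (-((n : ℝ) + s)))

/-- The Riesz-type potential `∫_E |x-y|^{-s} dx` of `E` evaluated at `y`. -/
def rieszAt (n : ℕ) (s : ℝ) (E : Set (Rn n)) (y : Rn n) : ℝ≥0∞ :=
  ∫⁻ x in E, ENNReal.ofReal (‖x - y‖ ^ (-s))

/-- `V_s(E) = max_{y ∈ ℝⁿ} ∫_E |x-y|^{-s} dx`. -/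
def Vs (n : ℕ) (s : ℝ) (E : Set (Rn n)) : ℝ≥0∞ := ⨆ y : Rn n, rieszAt n s E y

/-- `ω_n`, the volume of the unit ball of `ℝⁿ`. -/
def unitBallVol (n : ℕ) : ℝ := (volume (ball (0 : Rn n) 1)).toReal

/-- The radius `r` such that `|B_r| = |E|`. -/
def ballRad (n : ℕ) (E : Set (Rn n)) : ℝ :=
  ((volume E).toReal / unitBallVol n) ^ ((1 : ℝ) / n)

/-- The fractional isoperimetric deficit `δ_s(E) = (P_s(E) - P_s(B_r))/P_s(B_r)`,
where `|B_r| = |E|`. -/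
def fracDeficit (n : ℕ) (s : ℝ) (E : Set (Rn n)) : ℝ :=
  ((fracPer n s E).toReal - (fracPer n s (ball (0 : Rn n) (ballRad n E))).toReal) /
    (fracPer n s (ball (0 : Rn n) (ballRad n E))).toReal

/-- The normalization constant `c_{n,s} = P_s(B₁)(n-s)/(n ω_n)`. -/
def cns (n : ℕ) (s : ℝ) : ℝ :=
  (fracPer n s (ball (0 : Rn n) 1)).toReal * ((n : ℝ) - s) / (n * unitBallVol n)

/-- The strong asymmetry index
`A_s(E) = min_y { |E Δ B_r(y)|/|B_r| + ((P_s(E) - c_{n,s} ∫_E |x-y|^{-s} dx)/P_s(B_r))^{1/2} }`,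
with `|B_r| = |E|`. -/
def asymA (n : ℕ) (s : ℝ) (E : Set (Rn n)) : ℝ :=
  ⨅ y : Rn n,
    ((volume (E ∆ ball y (ballRad n E))).toReal /
        (volume (ball (0 : Rn n) (ballRad n E))).toReal +
      Real.sqrt (((fracPer n s E).toReal - cns n s * (rieszAt n s E y).toReal) /
        (fracPer n s (ball (0 : Rn n) (ballRad n E))).toReal))

/-- The oscillation index `β_s(E) = ((P_s(E) - c_{n,s} V_s(E))/P_s(B_r))^{1/2}`,
with `|B_r| = |E|`. -/
def betaS (n : ℕ) (s : ℝ) (E : Set (Rn n)) : ℝ :=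
  Real.sqrt (((fracPer n s E).toReal - cns n s * (Vs n s E).toReal) /
    (fracPer n s (ball (0 : Rn n) (ballRad n E))).toReal)

/-- The asymmetry index `ζ_s(E) = (V_s(B_r) - V_s(E))/V_s(B_r)`, with `|B_r| = |E|`. -/
def zetaS (n : ℕ) (s : ℝ) (E : Set (Rn n)) : ℝ :=
  ((Vs n s (ball (0 : Rn n) (ballRad n E))).toReal - (Vs n s E).toReal) /
    (Vs n s (ball (0 : Rn n) (ballRad n E))).toReal

/-- The Fraenkel asymmetry `α(E) = min_y |E Δ B_r(y)|/|B_r|`, with `|B_r| = |E|`. -/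
def fraenkel (n : ℕ) (E : Set (Rn n)) : ℝ :=
  ⨅ y : Rn n, (volume (E ∆ ball y (ballRad n E))).toReal /
    (volume (ball (0 : Rn n) (ballRad n E))).toReal

/-- The fractional Cheeger constant `h_{m,s}(Ω) = inf { P_s(E)/|E|^m : E ⊆ Ω }`. -/
def cheeger (n : ℕ) (m s : ℝ) (Ω : Set (Rn n)) : ℝ :=
  sInf {x : ℝ | ∃ E : Set (Rn n), E ⊆ Ω ∧ MeasurableSet E ∧ 0 < volume E ∧
    x = (fracPer n s E).toReal / (volume E).toReal ^ m}

/-- The energy functional `E_s(E) = P_s(E) + ε V_s(E)`. -/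
def energy (n : ℕ) (s ε : ℝ) (E : Set (Rn n)) : ℝ≥0∞ :=
  fracPer n s E + ENNReal.ofReal ε * Vs n s E

/-- The generalized energy functional `Ẽ_s({E^k}) = Σ_k E_s(E^k)`. -/
def genEnergy (n : ℕ) (s ε : ℝ) (F : ℕ → Set (Rn n)) : ℝ≥0∞ :=
  ∑' k : ℕ, energy n s ε (F k)

/-- Absolute difference in `ℝ≥0∞` (equal to `|a - b|` for finite values). -/
def ennAbsDiff (a b : ℝ≥0∞) : ℝ≥0∞ := (a - b) + (b - a)

/-- The penalized generalized functional `Ẽ_{s,Λ}({E^k}) = Ẽ_s({E^k}) + Λ |Σ_k |E^k| - ω_n|`. -/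
def penEnergy (n : ℕ) (s ε Λ : ℝ) (F : ℕ → Set (Rn n)) : ℝ≥0∞ :=
  genEnergy n s ε F +
    ENNReal.ofReal Λ * ennAbsDiff (∑' k : ℕ, volume (F k)) (volume (ball (0 : Rn n) 1))

/-- `E` is a minimizer of `min { P_s(E) + ε V_s(E) : E ⊆ ℝⁿ measurable, |E| = ω_n }`. -/
def IsEnergyMin (n : ℕ) (s ε : ℝ) (E : Set (Rn n)) : Prop :=
  MeasurableSet E ∧ volume E = volume (ball (0 : Rn n) 1) ∧
    ∀ F : Set (Rn n), MeasurableSet F → volume F = volume (ball (0 : Rn n) 1) →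
      energy n s ε E ≤ energy n s ε F

theorem integrableOn_norm_rpow_neg_ball {n : ℕ} (hn : 1 ≤ n) {s : ℝ} (hs : s < 1) (r : ℝ) :
    IntegrableOn (fun x : Rn n => ‖x‖ ^ (-s)) (ball 0 r) := by
  have : Nonempty (Fin n) := ⟨⟨0, hn⟩⟩
  refine (integrableOn_fun_norm_addHaar volume (f := fun t : ℝ => t ^ (-s))).2 ?_
  rcases le_total r 0 with hr | hr
  · simp [Ioo_eq_empty (not_lt.2 hr)]
  have h : IntegrableOn (fun t : ℝ => t ^ (-s)) (Icc 0 r) :=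
    (intervalIntegrable_iff_integrableOn_Icc_of_le hr).1
      (intervalIntegral.intervalIntegrable_rpow' (by linarith))
  exact (h.continuousOn_mul (by fun_prop) isCompact_Icc).mono_set Ioo_subset_Icc_self

theorem setIntegral_norm_rpow_neg_ball {n : ℕ} (s : ℝ) {r : ℝ} (hr : 0 < r) :
    ∫ x in ball (0 : Rn n) r, ‖x‖ ^ (-s) =
      r ^ n * r ^ (-s) * ∫ x in ball (0 : Rn n) 1, ‖x‖ ^ (-s) := by
  have h := Measure.setIntegral_comp_smul_of_pos (volume : Measure (Rn n))
    (fun x : Rn n => ‖x‖ ^ (-s)) (ball 0 1) hr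
  have h2 : ∀ x : Rn n, ‖r • x‖ ^ (-s) = r ^ (-s) * ‖x‖ ^ (-s) := fun x => by
    rw [norm_smul, Real.norm_of_nonneg hr.le, Real.mul_rpow hr.le (norm_nonneg _)]
  simp only [h2, integral_const_mul, finrank_euclideanSpace_fin, smul_unitBall_of_pos hr,
    smul_eq_mul] at h
  rw [mul_assoc, h, mul_inv_cancel_left₀ (by positivity)]

theorem setIntegral_norm_sub_rpow_neg_ball {n : ℕ} (s r : ℝ) (y : Rn n) :
    ∫ x in ball y r, ‖x - y‖ ^ (-s) = ∫ x in ball (0 : Rn n) r, ‖x‖ ^ (-s) := by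
  rw [← integral_indicator measurableSet_ball, ← integral_indicator measurableSet_ball,
    ← integral_sub_right_eq_self ((ball (0 : Rn n) r).indicator fun x => ‖x‖ ^ (-s)) y]
  congr 1
  ext x
  simp [indicator, mem_ball, dist_eq_norm]

theorem integrableOn_norm_sub_rpow_neg_ball {n : ℕ} (hn : 1 ≤ n) {s : ℝ} (hs : s < 1) (r : ℝ)
    (y : Rn n) : IntegrableOn (fun x : Rn n => ‖x - y‖ ^ (-s)) (ball y r) := by
  have h := (integrableOn_norm_rpow_neg_ball hn hs r).integrable_indicator measurableSet_ball
  rw [← integrable_indicator_iff measurableSet_ball]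
  refine (h.comp_sub_right y).congr (.of_forall fun x => ?_)
  simp [indicator, mem_ball, dist_eq_norm]

theorem volume_real_ball_Rn {n : ℕ} (y : Rn n) {r : ℝ} (hr : 0 < r) :
    volume.real (ball y r) = r ^ n * unitBallVol n := by
  rw [measureReal_def, Measure.addHaar_ball_of_pos _ _ hr, ENNReal.toReal_mul,
    ENNReal.toReal_ofReal (by positivity), finrank_euclideanSpace_fin, unitBallVol]

theorem unitBallVol_pos (n : ℕ) : 0 < unitBallVol n :=
  ENNReal.toReal_pos (measure_ball_pos _ _ one_pos).ne' measure_ball_lt_top.ne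

theorem one_add_mul_le_one_sub_rpow_neg {a u : ℝ} (ha : 0 ≤ a) (hu : u < 1) :
    1 + a * u ≤ (1 - u) ^ (-a) := by
  have h1 : 0 < 1 - u := by linarith
  rw [Real.rpow_def_of_pos h1]
  have := Real.log_le_sub_one_of_pos h1
  have := Real.add_one_le_exp (Real.log (1 - u) * -a)
  nlinarith

theorem integrableOn_norm_sub_rpow_neg {n : ℕ} (hn : 1 ≤ n) {s : ℝ} (hs0 : 0 < s) (hs : s < 1)
    {E : Set (Rn n)} (hE : MeasurableSet E) (hE' : volume E ≠ ⊤) (y : Rn n) :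
    IntegrableOn (fun x : Rn n => ‖x - y‖ ^ (-s)) E := by
  rw [← inter_union_sdiff E (ball y 1)]
  refine ((integrableOn_norm_sub_rpow_neg_ball hn hs 1 y).mono_set inter_subset_right).union ?_
  refine Measure.integrableOn_of_bounded (M := 1) (measure_ne_top_of_subset sdiff_subset hE') ?_ ?_
  · exact (by fun_prop : Measurable fun x : Rn n => ‖x - y‖ ^ (-s)).aestronglyMeasurable
  · refine (ae_restrict_iff' (hE.diff measurableSet_ball)).2 (.of_forall fun x hx => ?_)
    have hx1 : 1 ≤ ‖x - y‖ := by simpa [dist_eq_norm] using hx.2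
    rw [Real.norm_of_nonneg (by positivity)]
    exact Real.rpow_le_one_of_one_le_of_nonpos hx1 (by linarith)

/-- Bathtub-type estimate with a quantitative remainder. -/
theorem setIntegral_norm_sub_rpow_neg_add_le {n : ℕ} (hn : 1 ≤ n) {s : ℝ} (hs0 : 0 < s)
    (hs : s < 1) {r : ℝ} (hr : 0 < r) {E : Set (Rn n)} (hE : MeasurableSet E)
    (hEr : volume E = volume (ball (0 : Rn n) r)) (y : Rn n) :
    (∫ x in E, ‖x - y‖ ^ (-s)) + r ^ n * r ^ (-s) * (unitBallVol n * (s / (16 * n))) *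
        (volume.real (E ∆ ball y r) / (r ^ n * unitBallVol n)) ^ 2 ≤
      r ^ n * r ^ (-s) * ∫ x in ball (0 : Rn n) 1, ‖x‖ ^ (-s) := by
  have hω := unitBallVol_pos n
  have hn' : (0 : ℝ) < n := by exact_mod_cast hn
  set f : Rn n → ℝ := fun x => ‖x - y‖ ^ (-s)
  set B := ball y r
  set b : ℝ := r ^ n * unitBallVol n with hb
  have hb0 : 0 < b := by positivity
  have hBb : volume.real B = b := volume_real_ball_Rn y hr
  have hEb : volume.real E = b := by
    rw [measureReal_def, hEr, ← measureReal_def, volume_real_ball_Rn 0 hr]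
  have hBfin : volume B ≠ ⊤ := measure_ball_lt_top.ne
  have hEfin : volume E ≠ ⊤ := by rw [hEr]; exact measure_ball_lt_top.ne
  have hBm : MeasurableSet B := measurableSet_ball
  have hfE : IntegrableOn f E := integrableOn_norm_sub_rpow_neg hn hs0 hs hE hEfin y
  have hfB : IntegrableOn f B := integrableOn_norm_sub_rpow_neg_ball hn hs r y
  set m := volume.real (B \ E) with hm
  have hm0 : 0 ≤ m := measureReal_nonneg
  have h1 : volume.real (B ∩ E) + m = b := by
    rw [← hBb]; exact measureReal_inter_add_sdiff₀ hE.nullMeasurableSet hBfin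
  have h2 : volume.real (B ∩ E) + volume.real (E \ B) = b := by
    rw [← hEb, inter_comm]; exact measureReal_inter_add_sdiff₀ hBm.nullMeasurableSet hEfin
  have hEB : volume.real (E \ B) = m := by linarith
  have hmb : m ≤ b := by
    have : 0 ≤ volume.real (B ∩ E) := measureReal_nonneg
    linarith
  have hsymm : volume.real (E ∆ B) = 2 * m := by
    rw [Set.symmDiff_def, measureReal_union disjoint_sdiff_sdiff (hBm.diff hE)
      (measure_ne_top_of_subset sdiff_subset hEfin) (measure_ne_top_of_subset sdiff_subset hBfin),
      hEB, ← hm]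
    ring
  have hIE : ∫ x in E, f x = (∫ x in B ∩ E, f x) + ∫ x in E \ B, f x := by
    rw [inter_comm, integral_inter_add_sdiff hBm hfE]
  have hIB : r ^ n * r ^ (-s) * ∫ x in ball (0 : Rn n) 1, ‖x‖ ^ (-s) =
      (∫ x in B ∩ E, f x) + ∫ x in B \ E, f x := by
    rw [integral_inter_add_sdiff hE hfB, ← setIntegral_norm_rpow_neg_ball s hr,
      ← setIntegral_norm_sub_rpow_neg_ball s r y]
  have hout : ∫ x in E \ B, f x ≤ r ^ (-s) * m := by
    rw [← hEB, mul_comm, ← smul_eq_mul, ← setIntegral_const]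
    refine setIntegral_mono_on (hfE.mono_set sdiff_subset)
      (integrableOn_const (measure_ne_top_of_subset sdiff_subset hEfin)) (hE.diff hBm) ?_
    intro x hx
    have hx1 : r ≤ ‖x - y‖ := by simpa [B, dist_eq_norm] using hx.2
    exact Real.rpow_le_rpow_of_nonpos hr hx1 (by linarith)
  set t := m / b with ht
  have ht0 : 0 ≤ t := by positivity
  have ht1 : t ≤ 1 := (div_le_one hb0).2 hmb
  have hmt : m = t * b := by rw [ht]; field_simp
  set ρ := r * (1 - t / 2) ^ ((n : ℝ)⁻¹) with hρ
  have hu0 : 0 < 1 - t / 2 := by linarith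
  have hρ0 : 0 < ρ := by positivity
  have hρr : ρ ≤ r := by
    have : (1 - t / 2) ^ ((n : ℝ)⁻¹) ≤ 1 := Real.rpow_le_one hu0.le (by linarith) (by positivity)
    nlinarith
  have hρn : ρ ^ n = r ^ n * (1 - t / 2) := by
    rw [hρ, mul_pow, Real.rpow_inv_natCast_pow hu0.le (by omega)]
  have hρs : r ^ (-s) * (1 + s / n * (t / 2)) ≤ ρ ^ (-s) := by
    rw [hρ, Real.mul_rpow hr.le (by positivity), ← Real.rpow_mul hu0.le]
    have := one_add_mul_le_one_sub_rpow_neg (a := s / n) (u := t / 2) (by positivity) (by linarith)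
    have e : (n : ℝ)⁻¹ * -s = -(s / n) := by ring
    rw [e]
    gcongr
  set D := ball y ρ
  have hDB : D ⊆ B := ball_subset_ball hρr
  have hA := hBm.diff hE
  have hfA : IntegrableOn f (B \ E) := hfB.mono_set sdiff_subset
  have hAfin : volume (B \ E) ≠ ⊤ := measure_ne_top_of_subset sdiff_subset hBfin
  have hDm : MeasurableSet D := measurableSet_ball
  have hsplit : volume.real ((B \ E) ∩ D) + volume.real ((B \ E) \ D) = m :=
    measureReal_inter_add_sdiff₀ hDm.nullMeasurableSet hAfin
  have hq : volume.real ((B \ E) \ D) ≤ m / 2 := by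
    calc _ ≤ volume.real (B \ D) :=
          measureReal_mono (sdiff_subset_sdiff_left sdiff_subset)
            (measure_ne_top_of_subset sdiff_subset hBfin)
      _ = b - ρ ^ n * unitBallVol n := by
          rw [measureReal_sdiff hDB hDm, hBb, volume_real_ball_Rn y hρ0]
      _ = m / 2 := by rw [hρn, hmt, hb]; ring
  have hI1 : ρ ^ (-s) * volume.real ((B \ E) ∩ D) ≤ ∫ x in (B \ E) ∩ D, f x := by
    rw [mul_comm, ← smul_eq_mul, ← setIntegral_const]
    refine setIntegral_mono_on_ae
      (integrableOn_const (measure_ne_top_of_subset inter_subset_left hAfin))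
      (hfA.mono_set inter_subset_left) (hA.inter hDm) ?_
    have : Nonempty (Fin n) := ⟨⟨0, hn⟩⟩
    filter_upwards [compl_mem_ae_iff.2 (measure_singleton (μ := volume) y)] with x hxy hx
    have hx1 : ‖x - y‖ < ρ := by simpa [D, dist_eq_norm] using hx.2
    exact Real.rpow_le_rpow_of_nonpos (norm_pos_iff.2 (sub_ne_zero.2 hxy)) hx1.le (by linarith)
  have hI2 : r ^ (-s) * volume.real ((B \ E) \ D) ≤ ∫ x in (B \ E) \ D, f x := by
    rw [mul_comm, ← smul_eq_mul, ← setIntegral_const]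
    refine setIntegral_mono_on
      (integrableOn_const (measure_ne_top_of_subset sdiff_subset hAfin))
      (hfA.mono_set sdiff_subset) (hA.diff hDm) ?_
    intro x hx
    have hx1 : ‖x - y‖ < r := by simpa [B, dist_eq_norm] using hx.1.1
    have hx2 : ρ ≤ ‖x - y‖ := by simpa [D, dist_eq_norm] using hx.2
    exact Real.rpow_le_rpow_of_nonpos (hρ0.trans_le hx2) hx1.le (by linarith)
  have hI : ∫ x in B \ E, f x = (∫ x in (B \ E) ∩ D, f x) + ∫ x in (B \ E) \ D, f x :=
    (integral_inter_add_sdiff hDm hfA).symm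
  rw [hIE, hIB, hsymm]
  have hfin : r ^ n * r ^ (-s) * (unitBallVol n * (s / (16 * n))) * (2 * m / b) ^ 2 =
      (m / 2) * (r ^ (-s) * (s / n * (t / 2))) := by
    have : 2 * m / b = 2 * t := by rw [ht]; ring
    rw [this, hmt, hb]; ring
  rw [hfin]
  have hp : (m / 2) * (r ^ (-s) * (s / n * (t / 2))) ≤
      volume.real ((B \ E) ∩ D) * (ρ ^ (-s) - r ^ (-s)) := by
    gcongr
    · linarith
    · linarith
  have : r ^ (-s) * m = r ^ (-s) * volume.real ((B \ E) ∩ D) +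
      r ^ (-s) * volume.real ((B \ E) \ D) := by rw [← hsplit]; ring
  linarith

theorem rieszAt_eq_ofReal {n : ℕ} (hn : 1 ≤ n) {s : ℝ} (hs0 : 0 < s) (hs : s < 1)
    {E : Set (Rn n)} (hE : MeasurableSet E) (hE' : volume E ≠ ⊤) (y : Rn n) :
    rieszAt n s E y = ENNReal.ofReal (∫ x in E, ‖x - y‖ ^ (-s)) :=
  (ofReal_integral_eq_lintegral_ofReal (integrableOn_norm_sub_rpow_neg hn hs0 hs hE hE' y)
    (.of_forall fun _ => by positivity)).symm

theorem volume_ball_ballRad {n : ℕ} (hn : 1 ≤ n) {E : Set (Rn n)} (hE0 : 0 < volume E)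
    (hE' : volume E ≠ ⊤) :
    0 < ballRad n E ∧ volume E = volume (ball (0 : Rn n) (ballRad n E)) := by
  have hω := unitBallVol_pos n
  have hv : 0 < (volume E).toReal := ENNReal.toReal_pos hE0.ne' hE'
  have hr : 0 < ballRad n E := by unfold ballRad; positivity
  refine ⟨hr, ?_⟩
  rw [← ENNReal.toReal_eq_toReal_iff' hE' measure_ball_lt_top.ne, ← measureReal_def (s := ball _ _),
    volume_real_ball_Rn 0 hr, ballRad, one_div, Real.rpow_inv_natCast_pow (by positivity) (by omega)]
  field_simp

/-- For `n ≥ 2` and `s ∈ (0,1)` there is `C₀ > 0`, depending only on `n` and `s`, such that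
`ζ_s(E) ≥ C₀ α(E)²` for every measurable set `E ⊆ ℝⁿ` with `0 < |E| < ∞`. -/
theorem stmt_4 (n : ℕ) (hn : 2 ≤ n) (s : ℝ) (hs : s ∈ Set.Ioo (0 : ℝ) 1) :
    ∃ C₀ : ℝ, 0 < C₀ ∧ ∀ E : Set (Rn n), MeasurableSet E →
      0 < volume E → volume E ≠ ⊤ →
      C₀ * fraenkel n E ^ 2 ≤ zetaS n s E := by
  obtain ⟨hs0, hs1⟩ := hs
  have hn1 : 1 ≤ n := by omega
  have hn' : (0 : ℝ) < n := by exact_mod_cast hn1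
  have hω := unitBallVol_pos n
  set K := ∫ x in ball (0 : Rn n) 1, ‖x‖ ^ (-s)
  set c := unitBallVol n * (s / (16 * n))
  have hc0 : 0 < c := by positivity
  have hK : 0 < K := by
    have hne : Nonempty (Fin n) := ⟨⟨0, hn1⟩⟩
    have hle : ∫ _ in ball (0 : Rn n) 1, (1 : ℝ) ≤ K := by
      refine setIntegral_mono_on_ae (integrableOn_const measure_ball_lt_top.ne)
        (integrableOn_norm_rpow_neg_ball hn1 hs1 1) measurableSet_ball ?_
      filter_upwards [compl_mem_ae_iff.2 (measure_singleton (μ := volume) (0 : Rn n))] with x h0 hx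
      exact Real.one_le_rpow_of_pos_of_le_one_of_nonpos (norm_pos_iff.2 h0)
        (mem_ball_zero_iff.1 hx).le (by linarith)
    rw [setIntegral_const, smul_eq_mul, mul_one] at hle
    exact hω.trans_le hle
  refine ⟨c / K, by positivity, fun E hE hE0 hE' => ?_⟩
  obtain ⟨hr, hEr⟩ := volume_ball_ballRad hn1 hE0 hE'
  rw [zetaS]
  set r := ballRad n E
  set g := r ^ n * r ^ (-s)
  have hg0 : 0 < g := by positivity
  have hVB : Vs n s (ball (0 : Rn n) r) = ENNReal.ofReal (g * K) := by
    refine le_antisymm (iSup_le fun y => ?_) (le_iSup_of_le 0 ?_)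
    · rw [rieszAt_eq_ofReal hn1 hs0 hs1 measurableSet_ball measure_ball_lt_top.ne]
      refine ENNReal.ofReal_le_ofReal (le_trans ?_
        (setIntegral_norm_sub_rpow_neg_add_le hn1 hs0 hs1 hr measurableSet_ball rfl y))
      exact le_add_of_nonneg_right (by positivity)
    · rw [rieszAt_eq_ofReal hn1 hs0 hs1 measurableSet_ball measure_ball_lt_top.ne,
        setIntegral_norm_sub_rpow_neg_ball, setIntegral_norm_rpow_neg_ball s hr]
  have hα0 : 0 ≤ fraenkel n E := Real.iInf_nonneg fun y => by positivity
  have hα (y : Rn n) : fraenkel n E ≤ volume.real (E ∆ ball y r) / (r ^ n * unitBallVol n) := by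
    rw [← volume_real_ball_Rn 0 hr]
    exact ciInf_le ⟨0, by rintro _ ⟨y, rfl⟩; positivity⟩ y
  have hbound (y : Rn n) : (∫ x in E, ‖x - y‖ ^ (-s)) ≤ g * K - g * c * fraenkel n E ^ 2 := by
    have h := setIntegral_norm_sub_rpow_neg_add_le hn1 hs0 hs1 hr hE hEr y
    have : g * c * fraenkel n E ^ 2 ≤
        g * c * (volume.real (E ∆ ball y r) / (r ^ n * unitBallVol n)) ^ 2 := by
      gcongr
      exact hα y
    linarith
  have hVE : (Vs n s E).toReal ≤ g * K - g * c * fraenkel n E ^ 2 := by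
    refine ENNReal.toReal_le_of_le_ofReal
      ((setIntegral_nonneg hE fun x _ => by positivity).trans (hbound 0)) (iSup_le fun y => ?_)
    rw [rieszAt_eq_ofReal hn1 hs0 hs1 hE hE']
    exact ENNReal.ofReal_le_ofReal (hbound y)
  rw [hVB, ENNReal.toReal_ofReal (by positivity), le_div_iff₀ (by positivity)]
  have : c / K * fraenkel n E ^ 2 * (g * K) = g * c * fraenkel n E ^ 2 := by field_simp
  linarith
end
end

section
/- Let n ≥ 2 and s ∈ (0,1). For any two measurable sets E, F ⊂ ℝⁿ of finite measure one has |V_s(E) − V_s(F)| ≤ (n ω_n^{s/n}/(n−s)) |E Δ F|^{(n−s)/n}, where ω_n denotes the measure of the unit ball in ℝⁿ. -/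
open MeasureTheory Metric Set Filter
open scoped ENNReal NNReal symmDiff Topology

noncomputable section

theorem volume_lt_norm_sub_rpow_le (n : ℕ) {s t : ℝ} (hs : 0 < s) (ht : 0 < t) (y : Rn n) :
    volume {x : Rn n | t < ‖x - y‖ ^ (-s)} ≤
      ENNReal.ofReal (unitBallVol n * t ^ (-((n : ℝ) / s))) := by
  have hsub : {x : Rn n | t < ‖x - y‖ ^ (-s)} ⊆ ball y (t ^ (-s⁻¹)) := by
    intro x hx
    rw [mem_ofPred_eq] at hx
    rw [mem_ball, dist_eq_norm]
    rcases (norm_nonneg (x - y)).eq_or_lt with h0 | h0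
    · rw [← h0]; positivity
    · have h := Real.rpow_lt_rpow_of_neg ht hx (neg_neg_of_pos (inv_pos.mpr hs))
      rwa [← Real.rpow_mul h0.le, neg_mul_neg, mul_inv_cancel₀ hs.ne', Real.rpow_one] at h
  have hfin : volume (ball (0 : Rn n) 1) ≠ ⊤ := measure_ball_lt_top.ne
  refine (measure_mono hsub).trans_eq ?_
  rw [Measure.addHaar_ball_of_pos _ _ (by positivity), mul_comm, unitBallVol,
    ENNReal.ofReal_mul ENNReal.toReal_nonneg, ENNReal.ofReal_toReal hfin,
    finrank_euclideanSpace_fin, ← Real.rpow_natCast, ← Real.rpow_mul ht.le]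
  congr 4
  ring

theorem rieszAt_le_split (n : ℕ) {s T : ℝ} (hs : 0 < s) (hsn : s < n) (hT : 0 < T)
    {G : Set (Rn n)} (hGvol : volume G ≠ ⊤) (y : Rn n) :
    rieszAt n s G y ≤ ENNReal.ofReal ((volume G).toReal * T +
      unitBallVol n * (-T ^ (-((n : ℝ) / s) + 1) / (-((n : ℝ) / s) + 1))) := by
  have hns : -((n : ℝ) / s) < -1 := neg_lt_neg ((one_lt_div hs).mpr hsn)
  have hω := (unitBallVol_pos n).le
  have hlow : ∫⁻ t in Ioc 0 T, (volume.restrict G) {x : Rn n | t < ‖x - y‖ ^ (-s)} ≤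
      ENNReal.ofReal ((volume G).toReal * T) := by
    calc _ ≤ ∫⁻ _ in Ioc 0 T, volume G :=
          lintegral_mono fun t => (measure_mono (subset_univ _)).trans_eq
            (Measure.restrict_apply_univ _)
      _ = _ := by
          rw [setLIntegral_const, Real.volume_Ioc, sub_zero,
            ENNReal.ofReal_mul ENNReal.toReal_nonneg, ENNReal.ofReal_toReal hGvol]
  have hhigh : ∫⁻ t in Ioi T, (volume.restrict G) {x : Rn n | t < ‖x - y‖ ^ (-s)} ≤
      ENNReal.ofReal (unitBallVol n * (-T ^ (-((n : ℝ) / s) + 1) / (-((n : ℝ) / s) + 1))) := by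
    calc _ ≤ ∫⁻ t in Ioi T, ENNReal.ofReal (unitBallVol n * t ^ (-((n : ℝ) / s))) :=
          setLIntegral_mono' measurableSet_Ioi fun t ht =>
            (Measure.restrict_apply_le _ _).trans
              (volume_lt_norm_sub_rpow_le n hs (hT.trans ht) y)
      _ = _ := by
          rw [← integral_Ioi_rpow_of_lt hns hT, ← integral_const_mul,
            ofReal_integral_eq_lintegral_ofReal
              ((integrableOn_Ioi_rpow_of_lt hns hT).const_mul _)]
          filter_upwards [ae_restrict_mem measurableSet_Ioi] with t ht
          have : 0 < t := hT.trans ht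
          positivity
  have hcake := lintegral_eq_lintegral_meas_lt (volume.restrict G)
    (f := fun x : Rn n => ‖x - y‖ ^ (-s)) (Eventually.of_forall fun x => by positivity)
    (by fun_prop)
  rw [rieszAt, hcake, ← Ioc_union_Ioi_eq_Ioi hT.le,
    lintegral_union measurableSet_Ioi Ioc_disjoint_Ioi_same, ENNReal.ofReal_add (by positivity)]
  · exact add_le_add hlow hhigh
  · exact mul_nonneg hω (div_nonneg_of_nonpos (neg_nonpos.mpr (by positivity)) (by linarith))

theorem rieszAt_le (n : ℕ) {s : ℝ} (hs : 0 < s) (hsn : s < n)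
    {G : Set (Rn n)} (hGvol : volume G ≠ ⊤) (y : Rn n) :
    rieszAt n s G y ≤ ENNReal.ofReal ((n * unitBallVol n ^ (s / n) / ((n : ℝ) - s)) *
      (volume G).toReal ^ (((n : ℝ) - s) / n)) := by
  by_cases h0 : volume G = 0
  · rw [rieszAt, Measure.restrict_eq_zero.mpr h0, lintegral_zero_measure]
    exact zero_le
  have hn : (0 : ℝ) < n := hs.trans hsn
  have hω := unitBallVol_pos n
  have hg : 0 < (volume G).toReal := ENNReal.toReal_pos h0 hGvol
  refine (rieszAt_le_split n hs hsn
    (T := (unitBallVol n / (volume G).toReal) ^ (s / n)) (by positivity) hGvol y).trans_eq ?_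
  congr 1
  generalize (volume G).toReal = g at *
  generalize unitBallVol n = ω at *
  have hr : 0 < ω / g := by positivity
  have hd : (n : ℝ) - s ≠ 0 := (sub_pos.mpr hsn).ne'
  have hpow : ((ω / g) ^ (s / n)) ^ (-((n : ℝ) / s)) = g / ω := by
    rw [← Real.rpow_mul hr.le, show s / n * -((n : ℝ) / s) = -1 by field_simp,
      Real.rpow_neg_one, inv_div]
  have hg' : g ^ (((n : ℝ) - s) / n) = g / g ^ (s / n) := by
    rw [sub_div, div_self hn.ne', Real.rpow_sub hg, Real.rpow_one]
  have hd' : -((n : ℝ) / s) + 1 = -((n - s) / s) := by field_simp; ring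
  rw [Real.rpow_add (by positivity), Real.rpow_one, hpow, hd', hg',
    Real.div_rpow hω.le hg.le]
  have : 0 < g ^ (s / n) := by positivity
  field_simp
  ring

theorem Vs_le (n : ℕ) {s : ℝ} (hs : 0 < s) (hsn : s < n)
    {G : Set (Rn n)} (hGvol : volume G ≠ ⊤) :
    Vs n s G ≤ ENNReal.ofReal ((n * unitBallVol n ^ (s / n) / ((n : ℝ) - s)) *
      (volume G).toReal ^ (((n : ℝ) - s) / n)) :=
  iSup_le (rieszAt_le n hs hsn hGvol)

theorem Vs_le_add_symmDiff (n : ℕ) (s : ℝ) (E F : Set (Rn n)) :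
    Vs n s E ≤ Vs n s F + Vs n s (E ∆ F) := by
  refine iSup_le fun y => ?_
  calc rieszAt n s E y ≤ rieszAt n s (F ∪ E ∆ F) y :=
        lintegral_mono_set fun x hx => by
          by_cases h : x ∈ F
          · exact Or.inl h
          · exact Or.inr (Or.inl ⟨hx, h⟩)
    _ ≤ rieszAt n s F y + rieszAt n s (E ∆ F) y := lintegral_union_le _ _ _
    _ ≤ _ := add_le_add (le_iSup (rieszAt n s F) y) (le_iSup (rieszAt n s (E ∆ F)) y)

/-- **Hölder continuity of `V_s` with respect to `L¹` convergence of sets.** For any measurable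
sets `E, F ⊆ ℝⁿ` of finite measure one has
`|V_s(E) - V_s(F)| ≤ (n ω_n^{s/n}/(n-s)) |E Δ F|^{(n-s)/n}`. -/
theorem stmt_5 (n : ℕ) (hn : 2 ≤ n) (s : ℝ) (hs : s ∈ Set.Ioo (0 : ℝ) 1)
    (E F : Set (Rn n)) (hE : MeasurableSet E) (hF : MeasurableSet F)
    (hEvol : volume E ≠ ⊤) (hFvol : volume F ≠ ⊤) :
    |(Vs n s E).toReal - (Vs n s F).toReal| ≤
      (n * unitBallVol n ^ (s / n) / ((n : ℝ) - s)) *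
        (volume (E ∆ F)).toReal ^ (((n : ℝ) - s) / n) := by
  have hsn : s < n := hs.2.trans (by exact_mod_cast (by lia : 1 < n))
  have hD : volume (E ∆ F) ≠ ⊤ :=
    measure_ne_top_of_subset symmDiff_subset_union (measure_union_ne_top hEvol hFvol)
  have hfin : ∀ {G : Set (Rn n)}, volume G ≠ ⊤ → Vs n s G ≠ ⊤ := fun hG =>
    ne_top_of_le_ne_top ENNReal.ofReal_ne_top (Vs_le n hs.1 hsn hG)
  have hsub : (0 : ℝ) < n - s := sub_pos.mpr hsn
  have hω := (unitBallVol_pos n).le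
  have hV := ENNReal.toReal_le_of_le_ofReal (by positivity) (Vs_le n hs.1 hsn hD)
  have hEF := ENNReal.toReal_mono (ENNReal.add_ne_top.mpr ⟨hfin hFvol, hfin hD⟩)
    (Vs_le_add_symmDiff n s E F)
  have hFE := ENNReal.toReal_mono (ENNReal.add_ne_top.mpr ⟨hfin hEvol, hfin hD⟩)
    (symmDiff_comm E F ▸ Vs_le_add_symmDiff n s F E)
  rw [ENNReal.toReal_add (hfin hFvol) (hfin hD)] at hEF
  rw [ENNReal.toReal_add (hfin hEvol) (hfin hD)] at hFE
  rw [abs_le]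
  constructor <;> linarith
end
end

section
/- Let n ≥ 2 and s ∈ (0,1). For every ε > 0 there exists η > 0 such that for every measurable set F ⊂ ℝⁿ with |F Δ B₁| < η, every V_s-center y_F of F satisfies |y_F| < ε, where B₁ is the unit ball centered at the origin. -/
open MeasureTheory Metric Set Filter
open scoped ENNReal NNReal symmDiff Topology

noncomputable section

/-- The Riesz kernel `z ↦ |z|^{-s}` with values in `ℝ≥0∞`. -/
def rieszKernel (n : ℕ) (s : ℝ) (z : Rn n) : ℝ≥0∞ := ENNReal.ofReal (‖z‖ ^ (-s))

lemma rieszKernel_le_one {n : ℕ} {s : ℝ} (hs : 0 ≤ s) {z : Rn n} (hz : 1 ≤ ‖z‖) :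
    rieszKernel n s z ≤ 1 := by
  unfold rieszKernel
  rw [ENNReal.ofReal_le_one]
  exact Real.rpow_le_one_of_one_le_of_nonpos hz (by linarith)

lemma ofReal_rpow_le_rieszKernel {n : ℕ} {s : ℝ} (hs : 0 ≤ s) {z : Rn n} (hz : z ≠ 0) {r : ℝ}
    (hr : ‖z‖ ≤ r) : ENNReal.ofReal (r ^ (-s)) ≤ rieszKernel n s z :=
  ENNReal.ofReal_le_ofReal <|
    Real.rpow_le_rpow_of_nonpos (norm_pos_iff.mpr hz) hr (by linarith)

lemma rieszAt_eq_setLIntegral_rieszKernel {n : ℕ} (s : ℝ) {E : Set (Rn n)} (hE : MeasurableSet E)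
    (y : Rn n) : rieszAt n s E y = ∫⁻ z in (fun z ↦ z + y) ⁻¹' E, rieszKernel n s z := by
  have hp : MeasurePreserving (fun z : Rn n ↦ z + y) volume volume :=
    measurePreserving_add_right volume y
  rw [rieszAt, ← hp.setLIntegral_comp_preimage hE (by fun_prop)]
  simp [rieszKernel]

lemma lintegral_ball_rieszKernel_ne_top {n : ℕ} (hn : 1 ≤ n) {s : ℝ} (hs : s < n) :
    ∫⁻ z in ball 0 1, rieszKernel n s z ≠ ∞ := by
  have h : IntegrableOn (fun z : Rn n ↦ ‖z‖ ^ (-s)) (ball 0 1) volume := by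
    refine integrableOn_ball_of_norm_le_rpow (C := 1) (α := s) (by simpa using hn)
      (by simpa using hs) (ae_of_all _ fun z ↦ ?_)
      (Measurable.aestronglyMeasurable (by fun_prop))
    rw [one_mul, Real.norm_of_nonneg (by positivity)]
  exact h.lintegral_lt_top.ne

lemma setLIntegral_rieszKernel_le {n : ℕ} {s : ℝ} (hs : 0 ≤ s) (G : Set (Rn n)) :
    ∫⁻ z in G, rieszKernel n s z ≤ (∫⁻ z in G ∩ ball 0 1, rieszKernel n s z) + volume G := by
  rw [← lintegral_inter_add_sdiff _ G measurableSet_ball]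
  gcongr
  calc ∫⁻ z in G \ ball 0 1, rieszKernel n s z ≤ ∫⁻ _ in G \ ball 0 1, 1 :=
        setLIntegral_mono measurable_const fun z hz ↦
          rieszKernel_le_one hs (by simpa using hz.2)
    _ ≤ volume G := by
        rw [setLIntegral_one]
        exact measure_mono sdiff_subset

/-- The Riesz potential of a set is small, uniformly in the base point, when the set is small. -/
lemma exists_rieszAt_lt {n : ℕ} (hn : 1 ≤ n) {s : ℝ} (hs₀ : 0 ≤ s) (hs : s < n) {κ : ℝ≥0∞}
    (hκ : κ ≠ 0) : ∃ η : ℝ, 0 < η ∧ ∀ G : Set (Rn n), MeasurableSet G →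
      volume G < ENNReal.ofReal η → ∀ y, rieszAt n s G y < κ := by
  have hκ' : κ / 2 ≠ 0 := ENNReal.half_pos hκ |>.ne'
  obtain ⟨δ, hδ, h⟩ := exists_pos_setLIntegral_lt_of_measure_lt
    (lintegral_ball_rieszKernel_ne_top hn hs) hκ'
  obtain ⟨η, hη, hηδ⟩ := ENNReal.lt_iff_exists_nnreal_btwn.1
    (show 0 < min δ (κ / 2) from lt_min hδ (pos_iff_ne_zero.2 hκ'))
  refine ⟨η, by exact_mod_cast hη, fun G hG hvol y ↦ ?_⟩
  rw [ENNReal.ofReal_coe_nnreal] at hvol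
  have hmap : MeasurePreserving (fun z : Rn n ↦ z + y) volume volume :=
    measurePreserving_add_right volume y
  have hG' := hmap.measurable hG
  rw [rieszAt_eq_setLIntegral_rieszKernel s hG]
  have hvol' : volume ((fun z ↦ z + y) ⁻¹' G) < min δ (κ / 2) := by
    rw [hmap.measure_preimage hG.nullMeasurableSet]
    exact hvol.trans hηδ
  have hball := h ((fun z ↦ z + y) ⁻¹' G)
    ((Measure.restrict_apply_le _ _).trans_lt (hvol'.trans_le (min_le_left _ _)))
  rw [Measure.restrict_restrict hG'] at hball
  calc _ ≤ _ := setLIntegral_rieszKernel_le hs₀ _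
    _ < κ / 2 + κ / 2 := ENNReal.add_lt_add hball (hvol'.trans_le (min_le_right _ _))
    _ = κ := ENNReal.add_halves κ

lemma rieszAt_le_add_symmDiff (n : ℕ) (s : ℝ) (E F : Set (Rn n)) (y : Rn n) :
    rieszAt n s E y ≤ rieszAt n s F y + rieszAt n s (E ∆ F) y :=
  calc rieszAt n s E y ≤ rieszAt n s (F ∪ E ∆ F) y :=
        lintegral_mono_set fun x hx ↦ by
          by_cases hF : x ∈ F
          · exact Or.inl hF
          · exact Or.inr (Or.inl ⟨hx, hF⟩)
    _ ≤ _ := lintegral_union_le _ _ _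

/-- Moving the base point at distance at least `ε` from the center of the unit ball decreases the
Riesz potential by a definite amount. -/
lemma exists_rieszAt_ball_add_le {n : ℕ} (hn : 1 ≤ n) {s : ℝ} (hs : 0 < s) {ε : ℝ} (hε : 0 < ε) :
    ∃ γ : ℝ≥0∞, γ ≠ 0 ∧ ∀ y : Rn n, ε ≤ ‖y‖ →
      rieszAt n s (ball 0 1) y + γ ≤ rieszAt n s (ball 0 1) 0 := by
  have : Nonempty (Fin n) := ⟨⟨0, hn⟩⟩
  wlog hε1 : ε ≤ 1 generalizing ε
  · obtain ⟨γ, hγ, h⟩ := this one_pos le_rfl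
    exact ⟨γ, hγ, fun y hy ↦ h y ((not_le.1 hε1).le.trans hy)⟩
  set q : ℝ := (1 - ε / 4) ^ (-s) - 1 with hq
  have hqpos : 0 < q := by
    have := Real.one_lt_rpow_of_pos_of_lt_one_of_neg (x := 1 - ε / 4) (z := -s)
      (by linarith) (by linarith) (by linarith)
    linarith
  refine ⟨ENNReal.ofReal q * volume (ball (0 : Rn n) (ε / 4)), mul_ne_zero
    (by simpa using hqpos) (measure_ball_pos volume _ (by linarith)).ne', fun y hy ↦ ?_⟩
  have hmap : MeasurePreserving (fun z : Rn n ↦ z + y) volume volume :=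
    measurePreserving_add_right volume y
  have hy0 : 0 < ‖y‖ := hε.trans_le hy
  rw [rieszAt_eq_setLIntegral_rieszKernel s measurableSet_ball,
    rieszAt_eq_setLIntegral_rieszKernel s measurableSet_ball]
  simp only [add_zero, preimage_id']
  set B : Set (Rn n) := ball 0 1
  set A : Set (Rn n) := (fun z ↦ z + y) ⁻¹' B with hA
  have hBm : MeasurableSet B := measurableSet_ball
  have hAm : MeasurableSet A := hmap.measurable hBm
  have hvol : volume (A \ B) = volume (B \ A) :=
    measure_sdiff_symm hAm.nullMeasurableSet hBm.nullMeasurableSet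
      (hmap.measure_preimage hBm.nullMeasurableSet)
      ((measure_mono inter_subset_right).trans_lt measure_ball_lt_top).ne
  set c : Rn n := ((1 - ε / 2) / ‖y‖) • y with hc
  set D : Set (Rn n) := ball c (ε / 4) with hD
  have hcn : ‖c‖ = 1 - ε / 2 := by
    rw [hc, norm_smul, Real.norm_of_nonneg (div_nonneg (by linarith) hy0.le),
      div_mul_cancel₀ _ hy0.ne']
  have hcy : ‖c + y‖ = 1 - ε / 2 + ‖y‖ := by
    have : c + y = ((1 - ε / 2) / ‖y‖ + 1) • y := by rw [add_smul, one_smul]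
    rw [this, norm_smul, Real.norm_of_nonneg
      (add_nonneg (div_nonneg (by linarith) hy0.le) zero_le_one), add_mul,
      div_mul_cancel₀ _ hy0.ne', one_mul]
  have hDn : ∀ z ∈ D, ‖z‖ ≤ 1 - ε / 4 := fun z hz ↦ by
    have h1 : ‖z - c‖ < ε / 4 := by simpa [hD, dist_eq_norm] using hz
    have h2 := norm_le_norm_add_norm_sub' z c
    linarith
  have hDsub : D ⊆ B \ A := fun z hz ↦ by
    have h1 : ‖z - c‖ < ε / 4 := by simpa [hD, dist_eq_norm] using hz
    have h2 := hDn z hz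
    have h3 : ‖c + y‖ ≤ ‖z + y‖ + ‖z - c‖ := by
      have := norm_sub_le (z + y) (z - c)
      rwa [show z + y - (z - c) = c + y by abel] at this
    refine ⟨by simp only [B, mem_ball_zero_iff]; linarith, ?_⟩
    simp only [hA, B, mem_preimage, mem_ball_zero_iff, not_lt]
    linarith
  have hDvol : volume D = volume (ball (0 : Rn n) (ε / 4)) := Measure.addHaar_ball_center _ _ _
  have hout : ∫⁻ z in A \ B, rieszKernel n s z ≤ volume (B \ A) :=
    calc _ ≤ ∫⁻ _ in A \ B, 1 := setLIntegral_mono measurable_const fun z hz ↦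
          rieszKernel_le_one hs.le (by simpa [B] using hz.2)
      _ = volume (B \ A) := by rw [setLIntegral_one, hvol]
  have hin : volume (B \ A) + ENNReal.ofReal q * volume D ≤ ∫⁻ z in B \ A, rieszKernel n s z := by
    calc volume (B \ A) + ENNReal.ofReal q * volume D
        = ∫⁻ z in B \ A, (1 + D.indicator (fun _ ↦ ENNReal.ofReal q) z) := by
          rw [lintegral_add_left measurable_const, setLIntegral_one,
            lintegral_indicator_const measurableSet_ball,
            Measure.restrict_apply measurableSet_ball, inter_eq_left.2 hDsub]
      _ ≤ _ := by
          refine lintegral_mono_ae ?_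
          filter_upwards [ae_restrict_mem (hBm.diff hAm),
            ae_restrict_of_ae (Measure.ae_ne volume (0 : Rn n))] with z hz hz0
          by_cases hzD : z ∈ D
          · rw [indicator_of_mem hzD, ← ENNReal.ofReal_one,
              ← ENNReal.ofReal_add zero_le_one hqpos.le]
            convert ofReal_rpow_le_rieszKernel hs.le hz0 (hDn z hzD) using 2
            rw [hq]; ring
          · rw [indicator_of_notMem hzD, add_zero]
            simpa using ofReal_rpow_le_rieszKernel hs.le hz0
              (r := 1) (by simpa [B] using hz.1 |> mem_ball_zero_iff.1 |>.le)
  rw [← lintegral_inter_add_sdiff _ A hBm, ← lintegral_inter_add_sdiff _ B hAm, inter_comm B A,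
    ← hDvol, add_assoc]
  gcongr
  exact (add_le_add_left hout _).trans hin

/-- **`V_s`-centers of sets close to the unit ball are close to the origin.** For every `ε > 0`
there is `η > 0` such that if `|F Δ B₁| < η`, then every `V_s`-center `y` of `F`
satisfies `|y| < ε`. -/
theorem stmt_7 (n : ℕ) (hn : 2 ≤ n) (s : ℝ) (hs : s ∈ Set.Ioo (0 : ℝ) 1) :
    ∀ ε : ℝ, 0 < ε → ∃ η : ℝ, 0 < η ∧
      ∀ F : Set (Rn n), MeasurableSet F →
        volume (F ∆ ball (0 : Rn n) 1) < ENNReal.ofReal η →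
        ∀ y : Rn n, rieszAt n s F y = Vs n s F → ‖y‖ < ε := by
  intro ε hε
  have hn1 : 1 ≤ n := by omega
  have hsn : s < n := hs.2.trans_le (by exact_mod_cast hn1)
  obtain ⟨γ, hγ, hgap⟩ := exists_rieszAt_ball_add_le hn1 hs.1 hε
  obtain ⟨η, hη, hsmall⟩ := exists_rieszAt_lt hn1 hs.1.le hsn (ENNReal.half_pos hγ).ne'
  refine ⟨η, hη, fun F hF hvol y hy ↦ ?_⟩
  by_contra! hyε
  have hlt := hsmall _ (hF.symmDiff measurableSet_ball) hvol
  have hfin : rieszAt n s (ball 0 1) y ≠ ∞ := by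
    have h0 : rieszAt n s (ball 0 1) 0 ≠ ∞ := by
      simpa [rieszAt, rieszKernel] using lintegral_ball_rieszKernel_ne_top hn1 hsn
    exact ne_top_of_le_ne_top h0 (le_self_add.trans (hgap y hyε))
  refine lt_irrefl (rieszAt n s (ball 0 1) y + γ) ?_
  calc rieszAt n s (ball 0 1) y + γ ≤ rieszAt n s (ball 0 1) 0 := hgap y hyε
    _ ≤ rieszAt n s F 0 + rieszAt n s (F ∆ ball 0 1) 0 := by
        rw [symmDiff_comm]
        exact rieszAt_le_add_symmDiff n s _ _ 0
    _ ≤ rieszAt n s F y + rieszAt n s (F ∆ ball 0 1) 0 := by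
        gcongr
        rw [hy]
        exact le_iSup (rieszAt n s F) 0
    _ ≤ rieszAt n s (ball 0 1) y + rieszAt n s (F ∆ ball 0 1) y
          + rieszAt n s (F ∆ ball 0 1) 0 := by
        gcongr
        exact rieszAt_le_add_symmDiff n s _ _ y
    _ = rieszAt n s (ball 0 1) y
          + (rieszAt n s (F ∆ ball 0 1) y + rieszAt n s (F ∆ ball 0 1) 0) := add_assoc _ _ _
    _ < rieszAt n s (ball 0 1) y + (γ / 2 + γ / 2) :=
        ENNReal.add_lt_add_left hfin (ENNReal.add_lt_add (hlt y) (hlt 0))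
    _ = rieszAt n s (ball 0 1) y + γ := by rw [ENNReal.add_halves]
end
end

section
/- Let n ≥ 2, s ∈ (0,1) and ε > 0. Then inf{ E_s(E) : E ⊂ ℝⁿ measurable, |E| = ω_n } = inf{ Σ_{k=1}^∞ E_s(E^k) : {E^k}_{k∈ℕ} measurable sets with Σ_{k=1}^∞ |E^k| = ω_n }, where ω_n = |B₁|. -/
open MeasureTheory Metric Set Filter
open scoped ENNReal NNReal symmDiff Topology

noncomputable section

theorem setLIntegral_preimage_of_map {α : Type*} [MeasurableSpace α] {μ : Measure α} (g : α ≃ᵐ α)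
    {c : ℝ≥0∞} (hg : μ.map g = c • μ) (A : Set α) (f : α → ℝ≥0∞) :
    ∫⁻ x in g ⁻¹' A, f (g x) ∂μ = c * ∫⁻ x in A, f x ∂μ := by
  rw [← lintegral_map_equiv f g, ← g.restrict_map, hg, Measure.restrict_smul,
    lintegral_smul_measure, smul_eq_mul]

theorem ofReal_rpow_neg_norm_eq {n : ℕ} {g : Rn n → Rn n} {t : ℝ} (ht : 0 < t)
    (hd : ∀ x y, ‖g x - g y‖ = t * ‖x - y‖) (p : ℝ) (x y : Rn n) :
    ENNReal.ofReal (‖x - y‖ ^ (-p)) =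
      ENNReal.ofReal (t ^ p) * ENNReal.ofReal (‖g x - g y‖ ^ (-p)) := by
  rw [← ENNReal.ofReal_mul (by positivity), hd, Real.mul_rpow ht.le (norm_nonneg _), ← mul_assoc,
    ← Real.rpow_add ht, add_neg_cancel, Real.rpow_zero, one_mul]

theorem fracPer_preimage_similarity {n : ℕ} (g : Rn n ≃ᵐ Rn n) {t : ℝ} (ht : 0 < t)
    (hd : ∀ x y, ‖g x - g y‖ = t * ‖x - y‖)
    (hg : (volume : Measure (Rn n)).map g = ENNReal.ofReal (t ^ (-(n : ℝ))) • volume)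
    (s : ℝ) (A : Set (Rn n)) :
    fracPer n s (g ⁻¹' A) = ENNReal.ofReal (t ^ (s - n)) * fracPer n s A := by
  have inner (x : Rn n) : ∫⁻ y in (g ⁻¹' A)ᶜ, ENNReal.ofReal (‖x - y‖ ^ (-((n : ℝ) + s))) =
      ENNReal.ofReal (t ^ s) *
        ∫⁻ y in Aᶜ, ENNReal.ofReal (‖g x - y‖ ^ (-((n : ℝ) + s))) := by
    simp_rw [ofReal_rpow_neg_norm_eq ht hd ((n : ℝ) + s) x]
    rw [lintegral_const_mul' _ _ ENNReal.ofReal_ne_top, ← preimage_compl,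
      setLIntegral_preimage_of_map g hg Aᶜ
        (fun y => ENNReal.ofReal (‖g x - y‖ ^ (-((n : ℝ) + s)))),
      ← mul_assoc, ← ENNReal.ofReal_mul (by positivity), ← Real.rpow_add ht]
    ring_nf
  unfold fracPer
  simp_rw [inner]
  rw [lintegral_const_mul' _ _ ENNReal.ofReal_ne_top,
    setLIntegral_preimage_of_map g hg A
      (fun x => ∫⁻ y in Aᶜ, ENNReal.ofReal (‖x - y‖ ^ (-((n : ℝ) + s)))),
    ← mul_assoc, ← ENNReal.ofReal_mul (by positivity), ← Real.rpow_add ht, ← sub_eq_add_neg]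

theorem Vs_preimage_similarity {n : ℕ} (g : Rn n ≃ᵐ Rn n) {t : ℝ} (ht : 0 < t)
    (hd : ∀ x y, ‖g x - g y‖ = t * ‖x - y‖)
    (hg : (volume : Measure (Rn n)).map g = ENNReal.ofReal (t ^ (-(n : ℝ))) • volume)
    (s : ℝ) (A : Set (Rn n)) :
    Vs n s (g ⁻¹' A) = ENNReal.ofReal (t ^ (s - n)) * Vs n s A := by
  unfold Vs
  rw [ENNReal.mul_iSup,
    ← g.surjective.iSup_comp fun y => ENNReal.ofReal (t ^ (s - n)) * rieszAt n s A y]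
  congr 1 with y
  unfold rieszAt
  simp_rw [ofReal_rpow_neg_norm_eq ht hd s _ y]
  rw [lintegral_const_mul' _ _ ENNReal.ofReal_ne_top,
    setLIntegral_preimage_of_map g hg A (fun x => ENNReal.ofReal (‖x - g y‖ ^ (-s))),
    ← mul_assoc, ← ENNReal.ofReal_mul (by positivity), ← Real.rpow_add ht, ← sub_eq_add_neg]

theorem energy_preimage_similarity {n : ℕ} (g : Rn n ≃ᵐ Rn n) {t : ℝ} (ht : 0 < t)
    (hd : ∀ x y, ‖g x - g y‖ = t * ‖x - y‖)
    (hg : (volume : Measure (Rn n)).map g = ENNReal.ofReal (t ^ (-(n : ℝ))) • volume)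
    (s ε : ℝ) (A : Set (Rn n)) :
    energy n s ε (g ⁻¹' A) = ENNReal.ofReal (t ^ (s - n)) * energy n s ε A := by
  unfold energy
  rw [fracPer_preimage_similarity g ht hd hg, Vs_preimage_similarity g ht hd hg]
  ring

theorem energy_preimage_sub_right (n : ℕ) (s ε : ℝ) (A : Set (Rn n)) (v : Rn n) :
    energy n s ε ((fun x => x - v) ⁻¹' A) = energy n s ε A := by
  have hg : ⇑(MeasurableEquiv.subRight v) = fun x => x - v := rfl
  have h := energy_preimage_similarity (MeasurableEquiv.subRight v) one_pos
    (fun x y => by simp [hg]) (by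
      simpa [hg] using (measurePreserving_sub_right (volume : Measure (Rn n)) v).map_eq) s ε A
  simpa [hg] using h

theorem exists_dilation {n : ℕ} (s ε : ℝ) {r : ℝ} (hr : 0 < r) {A : Set (Rn n)}
    (hA : MeasurableSet A) :
    ∃ B : Set (Rn n), MeasurableSet B ∧ volume B = ENNReal.ofReal (r ^ (n : ℝ)) * volume A ∧
      energy n s ε B = ENNReal.ofReal (r ^ ((n : ℝ) - s)) * energy n s ε A := by
  have hr' : r⁻¹ ≠ 0 := (inv_pos.2 hr).ne'
  have hg : (volume : Measure (Rn n)).map (MeasurableEquiv.smul₀ r⁻¹ hr') =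
      ENNReal.ofReal (r⁻¹ ^ (-(n : ℝ))) • volume := by
    have h := Measure.map_addHaar_smul (volume : Measure (Rn n)) hr'
    rw [MeasurableEquiv.coe_smul₀, h, finrank_euclideanSpace_fin, abs_of_nonneg (by positivity),
      Real.rpow_neg (inv_pos.2 hr).le, Real.rpow_natCast]
  refine ⟨MeasurableEquiv.smul₀ r⁻¹ hr' ⁻¹' A, MeasurableEquiv.measurable _ hA, ?_, ?_⟩
  · rw [← MeasurableEquiv.map_apply, hg, Measure.smul_apply, smul_eq_mul,
      Real.inv_rpow hr.le, Real.rpow_neg hr.le, inv_inv]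
  · rw [energy_preimage_similarity _ (inv_pos.2 hr) (fun x y => by
      rw [MeasurableEquiv.coe_smul₀, ← smul_sub, norm_smul, Real.norm_of_nonneg
        (inv_pos.2 hr).le]) hg, Real.inv_rpow hr.le, ← Real.rpow_neg hr.le, neg_sub]

theorem fracPer_union_le (n : ℕ) (s : ℝ) (A B : Set (Rn n)) :
    fracPer n s (A ∪ B) ≤ fracPer n s A + fracPer n s B := by
  refine (lintegral_union_le _ _ _).trans (add_le_add ?_ ?_) <;>
  refine lintegral_mono fun x => lintegral_mono_set (compl_subset_compl.2 ?_)
  exacts [subset_union_left, subset_union_right]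

theorem Vs_union_le (n : ℕ) (s : ℝ) (A B : Set (Rn n)) :
    Vs n s (A ∪ B) ≤ Vs n s A + Vs n s B :=
  iSup_le fun y => (lintegral_union_le _ _ _).trans
    (add_le_add (le_iSup (rieszAt n s A) y) (le_iSup (rieszAt n s B) y))

theorem energy_union_le (n : ℕ) (s ε : ℝ) (A B : Set (Rn n)) :
    energy n s ε (A ∪ B) ≤ energy n s ε A + energy n s ε B := by
  unfold energy
  calc
    _ ≤ fracPer n s A + fracPer n s B + ENNReal.ofReal ε * (Vs n s A + Vs n s B) := by
      gcongr
      exacts [fracPer_union_le n s A B, Vs_union_le n s A B]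
    _ = _ := by ring

theorem energy_empty (n : ℕ) (s ε : ℝ) : energy n s ε ∅ = 0 := by
  simp [energy, fracPer, Vs, rieszAt]

theorem lintegral_measure_inter_preimage_sub {G : Type*} [AddCommGroup G] [MeasurableSpace G]
    [MeasurableAdd₂ G] [MeasurableNeg G] (μ : Measure G) [SFinite μ] [μ.IsAddLeftInvariant]
    [μ.IsNegInvariant] (A : Set G) {B : Set G} (hB : MeasurableSet B) :
    ∫⁻ v, μ (A ∩ (fun x => x - v) ⁻¹' B) ∂μ = μ A * μ B := by
  have hm : Measurable fun z : G × G => B.indicator (1 : G → ℝ≥0∞) (z.2 - z.1) :=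
    (measurable_one.indicator hB).comp (measurable_snd.sub measurable_fst)
  have h1 (v : G) : μ (A ∩ (fun x => x - v) ⁻¹' B) =
      ∫⁻ x in A, B.indicator (1 : G → ℝ≥0∞) (x - v) ∂μ := by
    rw [inter_comm, ← Measure.restrict_apply (measurable_sub_const v hB),
      ← lintegral_indicator_one (measurable_sub_const v hB)]
    rfl
  simp_rw [h1]
  rw [lintegral_lintegral_swap hm.aemeasurable]
  simp_rw [lintegral_sub_left_eq_self (μ := μ) (B.indicator (1 : G → ℝ≥0∞)),
    lintegral_indicator_one hB]
  rw [setLIntegral_const, mul_comm]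

theorem exists_measure_inter_preimage_sub_lt {n : ℕ} (hn : n ≠ 0) {A B : Set (Rn n)}
    (hB : MeasurableSet B) (hA' : volume A ≠ ∞) (hB' : volume B ≠ ∞)
    {δ : ℝ≥0∞} (hδ : δ ≠ 0) :
    ∃ v : Rn n, volume (A ∩ (fun x => x - v) ⁻¹' B) < δ := by
  have : NeZero n := ⟨hn⟩
  by_contra! h
  have h1 := lintegral_mono (μ := (volume : Measure (Rn n))) h
  rw [lintegral_measure_inter_preimage_sub volume A hB, lintegral_const,
    measure_univ_of_isAddLeftInvariant, ENNReal.mul_top hδ, top_le_iff] at h1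
  exact ENNReal.mul_ne_top hA' hB' h1

theorem exists_energy_le_sum {n : ℕ} (hn : n ≠ 0) (s ε : ℝ) {F : ℕ → Set (Rn n)}
    (hF : ∀ k, MeasurableSet (F k)) (hF' : ∀ k, volume (F k) ≠ ∞) (N : ℕ) :
    ∀ δ : ℝ≥0∞, δ ≠ 0 → ∃ E : Set (Rn n), MeasurableSet E ∧
      energy n s ε E ≤ ∑ k ∈ Finset.range N, energy n s ε (F k) ∧
      volume E ≤ ∑ k ∈ Finset.range N, volume (F k) ∧
      ∑ k ∈ Finset.range N, volume (F k) ≤ volume E + δ := by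
  induction N with
  | zero => exact fun δ _ => ⟨∅, .empty, by simp [energy_empty]⟩
  | succ N ih =>
    intro δ hδ
    have hδ2 : δ / 2 ≠ 0 := (ENNReal.half_pos hδ).ne'
    obtain ⟨E, hE, hen, hle, hge⟩ := ih (δ / 2) hδ2
    have hE' : volume E ≠ ∞ := ne_top_of_le_ne_top (ENNReal.sum_ne_top.2 fun k _ => hF' k) hle
    obtain ⟨v, hv⟩ := exists_measure_inter_preimage_sub_lt hn (hF N) hE' (hF' N) hδ2
    set T : Set (Rn n) := (fun x => x - v) ⁻¹' F N with hT
    have hTm : MeasurableSet T := measurable_sub_const v (hF N)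
    have hTv : volume T = volume (F N) :=
      (measurePreserving_sub_right volume v).measure_preimage (hF N).nullMeasurableSet
    refine ⟨E ∪ T, hE.union hTm, ?_, ?_, ?_⟩ <;> rw [Finset.sum_range_succ]
    · refine (energy_union_le n s ε E T).trans ?_
      rw [hT, energy_preimage_sub_right]
      gcongr
    · refine (measure_union_le E T).trans ?_
      rw [hTv]
      gcongr
    · calc
        _ ≤ volume E + δ / 2 + volume T := by rw [hTv]; gcongr
        _ = volume (E ∪ T) + volume (E ∩ T) + δ / 2 := by
          rw [measure_union_add_inter E hTm]; ring
        _ ≤ volume (E ∪ T) + δ / 2 + δ / 2 := by gcongr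
        _ = volume (E ∪ T) + δ := by rw [add_assoc, ENNReal.add_halves]

theorem exists_volume_eq_of_energy {n : ℕ} (hn : n ≠ 0) {s : ℝ} (hs : 0 ≤ s) (ε : ℝ)
    {A : Set (Rn n)} (hA : MeasurableSet A) {w : ℝ≥0∞} (hw : w ≠ ∞) (hA0 : volume A ≠ 0)
    (hAw : volume A ≤ w) :
    ∃ B : Set (Rn n), MeasurableSet B ∧ volume B = w ∧
      energy n s ε B ≤ w / volume A * energy n s ε A := by
  have hAt : volume A ≠ ∞ := ne_top_of_le_ne_top hw hAw
  have hqt : w / volume A ≠ ∞ := ENNReal.div_ne_top hw hA0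
  have hq1 : 1 ≤ w / volume A := by
    rwa [ENNReal.le_div_iff_mul_le (.inl hA0) (.inl hAt), one_mul]
  set q : ℝ := (w / volume A).toReal with hq
  have hqr : 1 ≤ q := by
    rw [hq, ← ENNReal.toReal_one]
    exact ENNReal.toReal_mono hqt hq1
  have hr1 : 1 ≤ q ^ ((n : ℝ)⁻¹) := Real.one_le_rpow hqr (by positivity)
  have hrn : (q ^ ((n : ℝ)⁻¹)) ^ (n : ℝ) = q :=
    Real.rpow_inv_rpow (by linarith) (by exact_mod_cast hn)
  obtain ⟨B, hB, hBv, hBe⟩ := exists_dilation s ε (one_pos.trans_le hr1) hA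
  refine ⟨B, hB, ?_, ?_⟩
  · rw [hBv, hrn, hq, ENNReal.ofReal_toReal hqt, ENNReal.div_mul_cancel hA0 hAt]
  · rw [hBe]
    gcongr
    rw [← ENNReal.ofReal_toReal hqt, ← hq]
    refine ENNReal.ofReal_le_ofReal ?_
    calc
      _ ≤ (q ^ ((n : ℝ)⁻¹)) ^ (n : ℝ) := Real.rpow_le_rpow_of_exponent_le hr1 (by linarith)
      _ = q := hrn

/-- **Equality of the classical and the generalized infima.** For `n ≥ 2`, `s ∈ (0,1)` and any
`ε > 0`, `inf { E_s(E) : |E| = ω_n } = inf { Σ_k E_s(E^k) : Σ_k |E^k| = ω_n }`. -/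
theorem stmt_8 (n : ℕ) (hn : 2 ≤ n) (s : ℝ) (hs : s ∈ Set.Ioo (0 : ℝ) 1)
    (ε : ℝ) (hε : 0 < ε) :
    sInf {x : ℝ≥0∞ | ∃ E : Set (Rn n), MeasurableSet E ∧
        volume E = volume (ball (0 : Rn n) 1) ∧ x = energy n s ε E} =
    sInf {x : ℝ≥0∞ | ∃ F : ℕ → Set (Rn n), (∀ k, MeasurableSet (F k)) ∧
        (∑' k : ℕ, volume (F k)) = volume (ball (0 : Rn n) 1) ∧ x = genEnergy n s ε F} := by
  refine le_antisymm (le_sInf ?_) (le_sInf ?_)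
  · rintro _ ⟨F, hF, hFv, rfl⟩
    have hn0 : n ≠ 0 := by lia
    have hw0 : volume (ball (0 : Rn n) 1) ≠ 0 := (measure_ball_pos volume 0 one_pos).ne'
    have hwt : volume (ball (0 : Rn n) 1) ≠ ∞ := measure_ball_lt_top.ne
    generalize volume (ball (0 : Rn n) 1) = w at *
    set L := sInf {x : ℝ≥0∞ | ∃ E : Set (Rn n), MeasurableSet E ∧ volume E = w ∧
      x = energy n s ε E}
    have key : ∀ c < w, L * c ≤ genEnergy n s ε F * w := by
      intro c hc
      obtain ⟨d, hcd, hdw⟩ := exists_between hc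
      obtain ⟨N, hN⟩ : ∃ N, d < ∑ k ∈ Finset.range N, volume (F k) := by
        rw [← hFv, ENNReal.tsum_eq_iSup_nat] at hdw
        exact lt_iSup_iff.1 hdw
      obtain ⟨E, hE, hen, hle, hge⟩ := exists_energy_le_sum hn0 s ε hF
        (fun k => ne_top_of_le_ne_top hwt (hFv ▸ ENNReal.le_tsum k)) N (d - c)
        (tsub_pos_of_lt hcd).ne'
      have hcE : c < volume E := by
        by_contra! h
        refine (hN.trans_le hge).not_ge ?_
        calc
          _ ≤ c + (d - c) := by gcongr
          _ = d := add_tsub_cancel_of_le hcd.le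
      have hEw : volume E ≤ w := hle.trans (hFv ▸ ENNReal.sum_le_tsum _)
      have hE0 : volume E ≠ 0 := (zero_le.trans_lt hcE).ne'
      obtain ⟨B, hB, hBv, hBe⟩ := exists_volume_eq_of_energy hn0 hs.1.le ε hE hwt hE0 hEw
      calc
        L * c ≤ energy n s ε B * volume E := by
          gcongr
          exact sInf_le ⟨B, hB, hBv, rfl⟩
        _ ≤ w / volume E * energy n s ε E * volume E := by gcongr
        _ = w / volume E * volume E * energy n s ε E := by ring
        _ = energy n s ε E * w := by
          rw [ENNReal.div_mul_cancel hE0 (ne_top_of_le_ne_top hwt hEw), mul_comm]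
        _ ≤ genEnergy n s ε F * w := by
          gcongr
          exact hen.trans (ENNReal.sum_le_tsum _)
    have hLw : L * w ≤ genEnergy n s ε F * w :=
      ENNReal.mul_le_of_forall_lt fun a ha c hc => (mul_le_mul_left ha.le c).trans (key c hc)
    exact (ENNReal.mul_le_mul_iff_left hw0 hwt).1 hLw
  · rintro _ ⟨E, hE, hEv, rfl⟩
    refine sInf_le ⟨fun k => if k = 0 then E else ∅, fun k => ?_, ?_, ?_⟩
    · dsimp only
      split_ifs
      exacts [hE, .empty]
    · rw [tsum_eq_single 0 (fun k hk => by simp [hk])]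
      exact hEv
    · rw [genEnergy, tsum_eq_single 0 (fun k hk => by simp [hk, energy_empty]), if_pos rfl]
end
end

section
/- Let n ≥ 2, s ∈ (0,1). For every ε₀ > 0 there exists a constant Λ̃ = C_{n,s}(1+ε₀) (for a suitable C_{n,s} > 0 depending only on n and s) such that for all ε ∈ (0, ε₀) and Λ > Λ̃: inf{ Ẽ_s({E^k}) : Σ_k |E^k| = ω_n } = inf over all sequences {E^k} of ( Ẽ_s({E^k}) + Λ |Σ_k |E^k| − ω_n| ); moreover any minimizer of the unconstrained penalized problem satisfies Σ_k |E^k| = ω_n. -/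
open MeasureTheory Metric Set Filter
open scoped ENNReal NNReal symmDiff Topology

noncomputable section

section Penalization

open scoped Pointwise

lemma setLIntegral_smul {n : ℕ} {c : ℝ} (hc : 0 < c) (E : Set (Rn n)) (f : Rn n → ℝ≥0∞) :
    ∫⁻ x in c • E, f x = ENNReal.ofReal (c ^ n) * ∫⁻ x in E, f (c • x) := by
  let e : Rn n ≃ᵐ Rn n := MeasurableEquiv.smul₀ c hc.ne'
  have he : ∀ x, e x = c • x := fun _ => rfl
  have hmap : Measure.map e (volume : Measure (Rn n)) =
      ENNReal.ofReal ((c ^ n)⁻¹) • volume := by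
    have := Measure.map_addHaar_smul (volume : Measure (Rn n)) hc.ne'
    rw [finrank_euclideanSpace_fin, abs_of_pos (by positivity)] at this
    exact this
  have hpre : e ⁻¹' (c • E) = E := by
    ext x
    simp [he, Set.smul_mem_smul_set_iff₀ hc.ne']
  have key : ENNReal.ofReal ((c ^ n)⁻¹) * ∫⁻ x in c • E, f x = ∫⁻ x in E, f (c • x) := by
    rw [← smul_eq_mul, ← lintegral_smul_measure, ← Measure.restrict_smul, ← hmap,
      e.measurableEmbedding.restrict_map, hpre, e.measurableEmbedding.lintegral_map]
    rfl
  rw [← key, ← mul_assoc, ← ENNReal.ofReal_mul (by positivity),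
    mul_inv_cancel₀ (by positivity), ENNReal.ofReal_one, one_mul]

lemma rieszAt_smul {n : ℕ} {s c : ℝ} (hc : 0 < c) (E : Set (Rn n)) (y : Rn n) :
    rieszAt n s (c • E) (c • y) = ENNReal.ofReal (c ^ ((n : ℝ) - s)) * rieszAt n s E y := by
  have h : ∀ x : Rn n, ENNReal.ofReal (‖c • x - c • y‖ ^ (-s)) =
      ENNReal.ofReal (c ^ (-s)) * ENNReal.ofReal (‖x - y‖ ^ (-s)) := fun x => by
    rw [← smul_sub, norm_smul, Real.norm_of_nonneg hc.le,
      Real.mul_rpow hc.le (norm_nonneg _), ENNReal.ofReal_mul (by positivity)]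
  simp only [rieszAt]
  rw [setLIntegral_smul hc]
  simp only [h]
  rw [lintegral_const_mul' _ _ ENNReal.ofReal_ne_top, ← mul_assoc,
    ← ENNReal.ofReal_mul (by positivity), ← Real.rpow_natCast, ← Real.rpow_add hc, sub_eq_add_neg]

lemma Vs_smul {n : ℕ} {s c : ℝ} (hc : 0 < c) (E : Set (Rn n)) :
    Vs n s (c • E) = ENNReal.ofReal (c ^ ((n : ℝ) - s)) * Vs n s E := by
  have hsurj : Function.Surjective (fun y : Rn n => c • y) :=
    fun y => ⟨c⁻¹ • y, smul_inv_smul₀ hc.ne' y⟩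
  simp only [Vs]
  rw [← hsurj.iSup_comp, ENNReal.mul_iSup]
  simp only [rieszAt_smul hc]

lemma compl_smul_set_of_pos {n : ℕ} {c : ℝ} (hc : 0 < c) (E : Set (Rn n)) :
    (c • E)ᶜ = c • Eᶜ := by
  simpa only [Units.smul_mk0] using (Set.smul_set_compl (a := Units.mk0 c hc.ne') (s := E)).symm

lemma fracPer_smul {n : ℕ} {s c : ℝ} (hc : 0 < c) (E : Set (Rn n)) :
    fracPer n s (c • E) = ENNReal.ofReal (c ^ ((n : ℝ) - s)) * fracPer n s E := by
  have h : ∀ x y : Rn n, ENNReal.ofReal (‖c • x - c • y‖ ^ (-((n : ℝ) + s))) =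
      ENNReal.ofReal (c ^ (-((n : ℝ) + s))) * ENNReal.ofReal (‖x - y‖ ^ (-((n : ℝ) + s))) :=
    fun x y => by
      rw [← smul_sub, norm_smul, Real.norm_of_nonneg hc.le,
        Real.mul_rpow hc.le (norm_nonneg _), ENNReal.ofReal_mul (by positivity)]
  simp only [fracPer]
  rw [compl_smul_set_of_pos hc, setLIntegral_smul hc]
  simp only [setLIntegral_smul hc, h]
  simp_rw [lintegral_const_mul' _ _ ENNReal.ofReal_ne_top]
  rw [← mul_assoc, ← mul_assoc, ← ENNReal.ofReal_mul (by positivity),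
    ← ENNReal.ofReal_mul (by positivity), ← Real.rpow_natCast, ← Real.rpow_add hc,
    ← Real.rpow_add hc]
  congr 3
  ring

lemma energy_smul {n : ℕ} {s ε c : ℝ} (hc : 0 < c) (E : Set (Rn n)) :
    energy n s ε (c • E) = ENNReal.ofReal (c ^ ((n : ℝ) - s)) * energy n s ε E := by
  simp only [energy, fracPer_smul hc, Vs_smul hc]
  ring

lemma genEnergy_smul {n : ℕ} {s ε c : ℝ} (hc : 0 < c) (F : ℕ → Set (Rn n)) :
    genEnergy n s ε (fun k => c • F k) =
      ENNReal.ofReal (c ^ ((n : ℝ) - s)) * genEnergy n s ε F := by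
  simp only [genEnergy, energy_smul hc, ENNReal.tsum_mul_left]

lemma tsum_volume_smul {n : ℕ} {c : ℝ} (hc : 0 < c) (F : ℕ → Set (Rn n)) :
    ∑' k, volume (c • F k) = ENNReal.ofReal (c ^ n) * ∑' k, volume (F k) := by
  simp only [Measure.addHaar_smul_of_nonneg _ hc.le, finrank_euclideanSpace_fin,
    ENNReal.tsum_mul_left]

lemma lintegral_rpow_norm_compl_unitBall_lt_top {n : ℕ} {s : ℝ} (hs : 0 < s) :
    ∫⁻ z in (ball (0 : Rn n) 1)ᶜ, ENNReal.ofReal (‖z‖ ^ (-((n : ℝ) + s))) < ∞ := by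
  have hfin := finite_integral_one_add_norm (E := Rn n) (μ := volume) (r := (n : ℝ) + s)
    (by rw [finrank_euclideanSpace_fin]; linarith)
  calc ∫⁻ z in (ball (0 : Rn n) 1)ᶜ, ENNReal.ofReal (‖z‖ ^ (-((n : ℝ) + s)))
      ≤ ∫⁻ z in (ball (0 : Rn n) 1)ᶜ, ENNReal.ofReal (2 ^ ((n : ℝ) + s)) *
          ENNReal.ofReal ((1 + ‖z‖) ^ (-((n : ℝ) + s))) := by
        refine setLIntegral_mono' measurableSet_ball.compl fun z hz => ?_
        have hz1 : 1 ≤ ‖z‖ := by simpa using hz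
        rw [← ENNReal.ofReal_mul (by positivity)]
        refine ENNReal.ofReal_le_ofReal ?_
        have h2 : (2 : ℝ) ^ ((n : ℝ) + s) = ((2 : ℝ)⁻¹) ^ (-((n : ℝ) + s)) := by
          rw [Real.rpow_neg (by norm_num), Real.inv_rpow (by norm_num), inv_inv]
        rw [h2, ← Real.mul_rpow (by norm_num) (by positivity)]
        refine Real.rpow_le_rpow_of_nonpos (by positivity) (by linarith) ?_
        have : (0 : ℝ) ≤ n := n.cast_nonneg
        linarith
    _ ≤ ∫⁻ z, ENNReal.ofReal (2 ^ ((n : ℝ) + s)) *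
          ENNReal.ofReal ((1 + ‖z‖) ^ (-((n : ℝ) + s))) := setLIntegral_le_lintegral _ _
    _ < ∞ := by
        rw [lintegral_const_mul' _ _ ENNReal.ofReal_ne_top]
        exact ENNReal.mul_lt_top ENNReal.ofReal_lt_top hfin

lemma lintegral_rpow_norm_compl_ball {n : ℕ} {s d : ℝ} (hd : 0 < d) :
    ∫⁻ z in (ball (0 : Rn n) d)ᶜ, ENNReal.ofReal (‖z‖ ^ (-((n : ℝ) + s))) =
      ENNReal.ofReal (d ^ (-s)) *
        ∫⁻ z in (ball (0 : Rn n) 1)ᶜ, ENNReal.ofReal (‖z‖ ^ (-((n : ℝ) + s))) := by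
  have h : ∀ z : Rn n, ENNReal.ofReal (‖d • z‖ ^ (-((n : ℝ) + s))) =
      ENNReal.ofReal (d ^ (-((n : ℝ) + s))) * ENNReal.ofReal (‖z‖ ^ (-((n : ℝ) + s))) :=
    fun z => by
      rw [norm_smul, Real.norm_of_nonneg hd.le,
        Real.mul_rpow hd.le (norm_nonneg _), ENNReal.ofReal_mul (by positivity)]
  have hball : ball (0 : Rn n) d = d • ball (0 : Rn n) 1 := by
    rw [smul_unitBall hd.ne', Real.norm_of_nonneg hd.le]
  rw [hball, compl_smul_set_of_pos hd, setLIntegral_smul hd]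
  simp only [h]
  rw [lintegral_const_mul' _ _ ENNReal.ofReal_ne_top, ← mul_assoc,
    ← ENNReal.ofReal_mul (by positivity), ← Real.rpow_natCast, ← Real.rpow_add hd]
  congr 3
  ring

lemma fracPer_unitBall_lt_top {n : ℕ} (hn : 1 ≤ n) {s : ℝ} (hs : s ∈ Set.Ioo (0 : ℝ) 1) :
    fracPer n s (ball (0 : Rn n) 1) < ∞ := by
  have : Nontrivial (Rn n) := by
    have : Nonempty (Fin n) := ⟨⟨0, hn⟩⟩
    infer_instance
  set J := ∫⁻ z in (ball (0 : Rn n) 1)ᶜ, ENNReal.ofReal (‖z‖ ^ (-((n : ℝ) + s))) with hJ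
  have hJfin : J < ∞ := lintegral_rpow_norm_compl_unitBall_lt_top hs.1
  have hinner : ∀ x ∈ ball (0 : Rn n) 1,
      ∫⁻ y in (ball (0 : Rn n) 1)ᶜ, ENNReal.ofReal (‖x - y‖ ^ (-((n : ℝ) + s))) ≤
        J * ENNReal.ofReal ((1 - ‖x‖) ^ (-s)) := by
    intro x hx
    have hx1 : ‖x‖ < 1 := by simpa using hx
    rw [mul_comm, hJ, ← lintegral_rpow_norm_compl_ball (sub_pos.2 hx1),
      ← lintegral_indicator measurableSet_ball.compl,
      ← lintegral_indicator measurableSet_ball.compl,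
      ← lintegral_sub_left_eq_self
        ((ball (0 : Rn n) (1 - ‖x‖))ᶜ.indicator fun z => ENNReal.ofReal (‖z‖ ^ (-((n : ℝ) + s)))) x]
    refine lintegral_mono fun y => ?_
    refine Set.indicator_apply_le' (fun hy => ?_) fun _ => zero_le
    have hy1 : 1 ≤ ‖y‖ := by simpa using hy
    have hxy : x - y ∈ (ball (0 : Rn n) (1 - ‖x‖))ᶜ := by
      have := norm_sub_norm_le y x
      rw [norm_sub_rev] at this
      simp only [mem_compl_iff, mem_ball_zero_iff, not_lt]
      linarith
    rw [Set.indicator_of_mem hxy]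
  have hint : IntegrableOn (fun x : Rn n => (1 - ‖x‖) ^ (-s)) (ball 0 1) := by
    have hr : IntegrableOn (fun r : ℝ => (1 - r) ^ (-s)) (Ioo 0 1) := by
      have h1 : IntervalIntegrable (fun r : ℝ => r ^ (-s)) volume 0 1 :=
        intervalIntegral.intervalIntegrable_rpow' (by linarith [hs.2])
      have h2 := (h1.comp_sub_left 1).symm
      rw [sub_zero, sub_self] at h2
      exact (intervalIntegrable_iff_integrableOn_Ioo_of_le zero_le_one).1 h2
    rw [integrableOn_fun_norm_addHaar volume (f := fun r : ℝ => (1 - r) ^ (-s))]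
    refine Integrable.mono' hr (by fun_prop) ?_
    refine ae_restrict_of_forall_mem measurableSet_Ioo fun r hr => ?_
    have h1r : 0 ≤ 1 - r := by linarith [hr.2]
    rw [norm_smul, Real.norm_of_nonneg (pow_nonneg hr.1.le _),
      Real.norm_of_nonneg (Real.rpow_nonneg h1r _)]
    exact mul_le_of_le_one_left (Real.rpow_nonneg h1r _) (pow_le_one₀ hr.1.le hr.2.le)
  calc fracPer n s (ball (0 : Rn n) 1)
      ≤ ∫⁻ x in ball (0 : Rn n) 1, J * ENNReal.ofReal ((1 - ‖x‖) ^ (-s)) :=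
        setLIntegral_mono' measurableSet_ball hinner
    _ < ∞ := by
        rw [lintegral_const_mul' _ _ hJfin.ne]
        exact ENNReal.mul_lt_top hJfin hint.lintegral_lt_top

lemma lintegral_rpow_norm_unitBall_lt_top {n : ℕ} (hn : 2 ≤ n) {s : ℝ}
    (hs : s ∈ Set.Ioo (0 : ℝ) 1) :
    ∫⁻ z in ball (0 : Rn n) 1, ENNReal.ofReal (‖z‖ ^ (-s)) < ∞ := by
  have : Nontrivial (Rn n) := by
    have : Nonempty (Fin n) := ⟨⟨0, by lia⟩⟩
    infer_instance
  have hint : IntegrableOn (fun x : Rn n => ‖x‖ ^ (-s)) (ball 0 1) := by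
    rw [integrableOn_fun_norm_addHaar volume (f := fun r : ℝ => r ^ (-s))]
    have hr : IntegrableOn (fun r : ℝ => r ^ (-s)) (Ioo 0 1) :=
      (intervalIntegral.integrableOn_Ioo_rpow_iff zero_lt_one).2 (by linarith [hs.2])
    refine Integrable.mono' hr (by fun_prop) ?_
    refine ae_restrict_of_forall_mem measurableSet_Ioo fun r hr => ?_
    rw [norm_smul, Real.norm_of_nonneg (pow_nonneg hr.1.le _),
      Real.norm_of_nonneg (Real.rpow_nonneg hr.1.le _)]
    exact mul_le_of_le_one_left (Real.rpow_nonneg hr.1.le _) (pow_le_one₀ hr.1.le hr.2.le)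
  exact hint.lintegral_lt_top

lemma Vs_unitBall_lt_top {n : ℕ} (hn : 2 ≤ n) {s : ℝ} (hs : s ∈ Set.Ioo (0 : ℝ) 1) :
    Vs n s (ball (0 : Rn n) 1) < ∞ := by
  have hfin := ENNReal.add_lt_top.2 ⟨lintegral_rpow_norm_unitBall_lt_top hn hs,
    measure_ball_lt_top (μ := volume) (x := (0 : Rn n)) (r := 1)⟩
  refine (iSup_le fun y => ?_).trans_lt hfin
  rw [rieszAt, ← lintegral_indicator measurableSet_ball,
    ← lintegral_indicator measurableSet_ball, ← lintegral_indicator_one measurableSet_ball,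
    ← lintegral_sub_right_eq_self
      ((ball (0 : Rn n) 1).indicator fun z => ENNReal.ofReal (‖z‖ ^ (-s))) y,
    ← lintegral_add_right _ (measurable_one.indicator measurableSet_ball)]
  refine lintegral_mono fun x => Set.indicator_apply_le' (fun hx => ?_) fun _ => zero_le
  by_cases hxy : x - y ∈ ball (0 : Rn n) 1
  · rw [Set.indicator_of_mem hxy]
    exact le_self_add
  · rw [Set.indicator_of_mem hx]
    refine le_add_left ?_
    have h1 : 1 ≤ ‖x - y‖ := by simpa using hxy
    rw [Pi.one_apply, ENNReal.ofReal_le_one]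
    exact Real.rpow_le_one_of_one_le_of_nonpos h1 (by linarith [hs.1])

lemma exists_scaling {n : ℕ} (hn : 1 ≤ n) (s : ℝ) {ε m w : ℝ} (hm : 0 < m) (hw : 0 < w)
    {F : ℕ → Set (Rn n)} (hF : ∀ k, MeasurableSet (F k))
    (hvol : ∑' k, volume (F k) = ENNReal.ofReal m) :
    ∃ c : ℝ, 0 < c ∧ c ^ n = w / m ∧ ∃ G : ℕ → Set (Rn n), (∀ k, MeasurableSet (G k)) ∧
      ∑' k, volume (G k) = ENNReal.ofReal w ∧
      genEnergy n s ε G = ENNReal.ofReal (c ^ ((n : ℝ) - s)) * genEnergy n s ε F := by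
  have hwm : 0 < w / m := div_pos hw hm
  have hc : 0 < (w / m) ^ (1 / (n : ℝ)) := Real.rpow_pos_of_pos hwm _
  have hcn : ((w / m) ^ (1 / (n : ℝ))) ^ n = w / m := by
    rw [one_div, Real.rpow_inv_natCast_pow hwm.le (by lia)]
  refine ⟨_, hc, hcn, fun k => (w / m) ^ (1 / (n : ℝ)) • F k,
    fun k => (hF k).const_smul_of_ne_zero hc.ne', ?_, genEnergy_smul hc F⟩
  rw [tsum_volume_smul hc, hcn, hvol, ← ENNReal.ofReal_mul hwm.le, div_mul_cancel₀ _ hm.ne']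

lemma genEnergy_single (n : ℕ) (s ε : ℝ) (E : Set (Rn n)) :
    genEnergy n s ε (fun k => if k = 0 then E else ∅) = energy n s ε E := by
  have h0 : energy n s ε (∅ : Set (Rn n)) = 0 := by
    simp [energy, fracPer, Vs, rieszAt]
  rw [genEnergy, tsum_eq_single 0 fun k hk => by rw [if_neg hk, h0], if_pos rfl]

lemma tsum_volume_single (n : ℕ) (E : Set (Rn n)) :
    ∑' k : ℕ, volume (if k = 0 then E else (∅ : Set (Rn n))) = volume E := by
  rw [tsum_eq_single 0 fun k hk => by rw [if_neg hk, measure_empty], if_pos rfl]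

lemma exists_genEnergy_lt_penEnergy {n : ℕ} (hn : 2 ≤ n) {s : ℝ} (hs : s ∈ Set.Ioo (0 : ℝ) 1)
    {ε Λ : ℝ} (hΛ : 0 < Λ)
    (hball : energy n s ε (ball (0 : Rn n) 1) < ENNReal.ofReal Λ * volume (ball (0 : Rn n) 1))
    {F : ℕ → Set (Rn n)} (hF : ∀ k, MeasurableSet (F k))
    (hvol : ∑' k, volume (F k) ≠ volume (ball (0 : Rn n) 1)) :
    ∃ G : ℕ → Set (Rn n), (∀ k, MeasurableSet (G k)) ∧
      ∑' k, volume (G k) = volume (ball (0 : Rn n) 1) ∧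
      genEnergy n s ε G < penEnergy n s ε Λ F := by
  have hn0 : (2 : ℝ) ≤ n := by exact_mod_cast hn
  by_cases hlarge : ENNReal.ofReal Λ * volume (ball (0 : Rn n) 1) ≤ penEnergy n s ε Λ F
  · refine ⟨fun k => if k = 0 then ball 0 1 else ∅, fun k => ?_, tsum_volume_single n _, ?_⟩
    · dsimp only
      split_ifs
      exacts [measurableSet_ball, MeasurableSet.empty]
    · rw [genEnergy_single]
      exact hball.trans_le hlarge
  rw [not_le] at hlarge
  obtain ⟨w, hw, hwv⟩ : ∃ w : ℝ, 0 < w ∧ volume (ball (0 : Rn n) 1) = ENNReal.ofReal w :=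
    ⟨_, ENNReal.toReal_pos (measure_ball_pos _ _ one_pos).ne' measure_ball_lt_top.ne,
      (ENNReal.ofReal_toReal measure_ball_lt_top.ne).symm⟩
  rw [hwv] at hvol hlarge ⊢
  have hpen : penEnergy n s ε Λ F = genEnergy n s ε F +
      ENNReal.ofReal Λ * ennAbsDiff (∑' k, volume (F k)) (ENNReal.ofReal w) := by
    rw [penEnergy, hwv]
  have hpenfin : penEnergy n s ε Λ F < ∞ := hlarge.trans_le le_top
  obtain ⟨m, hm, hmv⟩ : ∃ m : ℝ, 0 ≤ m ∧ ∑' k, volume (F k) = ENNReal.ofReal m := by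
    refine ⟨_, ENNReal.toReal_nonneg, (ENNReal.ofReal_toReal fun h => hpenfin.ne ?_).symm⟩
    rw [hpen, h, ennAbsDiff, ENNReal.top_sub ENNReal.ofReal_ne_top, top_add,
      ENNReal.mul_top (by simpa using hΛ), add_top]
  obtain ⟨e, he, hev⟩ : ∃ e : ℝ, 0 ≤ e ∧ genEnergy n s ε F = ENNReal.ofReal e := by
    refine ⟨_, ENNReal.toReal_nonneg, (ENNReal.ofReal_toReal fun h => hpenfin.ne ?_).symm⟩
    rw [hpen, h, top_add]
  have hdiff : ennAbsDiff (ENNReal.ofReal m) (ENNReal.ofReal w) = ENNReal.ofReal |m - w| := by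
    rw [ennAbsDiff, ← ENNReal.ofReal_sub _ hw.le, ← ENNReal.ofReal_sub _ hm]
    rcases le_total m w with h | h
    · rw [ENNReal.ofReal_of_nonpos (sub_nonpos.2 h), zero_add, abs_sub_comm,
        abs_of_nonneg (sub_nonneg.2 h)]
    · rw [ENNReal.ofReal_of_nonpos (sub_nonpos.2 h), add_zero, abs_of_nonneg (sub_nonneg.2 h)]
  have hpenr : penEnergy n s ε Λ F = ENNReal.ofReal (e + Λ * |m - w|) := by
    rw [hpen, hev, hmv, hdiff, ← ENNReal.ofReal_mul hΛ.le, ← ENNReal.ofReal_add he (by positivity)]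
  rw [hpenr, ← ENNReal.ofReal_mul hΛ.le, ENNReal.ofReal_lt_ofReal_iff (by positivity)] at hlarge
  have hne : m ≠ w := fun h => hvol (by rw [hmv, h])
  rw [hpenr]
  have hm0 : 0 < m := by
    by_contra! h
    have : m = 0 := le_antisymm h hm
    rw [this, zero_sub, abs_neg, abs_of_pos hw] at hlarge
    linarith
  obtain ⟨c, hc, hcn, G, hG, hGvol, hGen⟩ :=
    exists_scaling (ε := ε) (by lia : 1 ≤ n) s hm0 hw hF hmv
  refine ⟨G, hG, hGvol, ?_⟩
  have habs : 0 < |m - w| := abs_pos.2 (sub_ne_zero.2 hne)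
  have hpos : 0 < e + Λ * |m - w| := by positivity
  rw [hGen, hev, ← ENNReal.ofReal_mul (by positivity), ENNReal.ofReal_lt_ofReal_iff hpos]
  rcases lt_or_gt_of_ne hne with hlt | hgt
  · rw [abs_of_neg (sub_neg.2 hlt)] at hlarge ⊢
    have hem : e < Λ * m := by linarith
    have hc1 : 1 ≤ c := by
      by_contra! h
      have h1 := pow_lt_one₀ hc.le h (by lia : n ≠ 0)
      rw [hcn, div_lt_one hm0] at h1
      exact h1.not_gt hlt
    have hcs : c ^ ((n : ℝ) - s) ≤ w / m := by
      rw [← hcn, ← Real.rpow_natCast]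
      exact Real.rpow_le_rpow_of_exponent_le hc1 (by linarith [hs.1])
    calc c ^ ((n : ℝ) - s) * e ≤ w / m * e := mul_le_mul_of_nonneg_right hcs he
      _ = e + e / m * (w - m) := by field_simp; ring
      _ < e + Λ * -(m - w) := by
        rw [neg_sub]
        have : e / m < Λ := (div_lt_iff₀ hm0).2 hem
        have := mul_lt_mul_of_pos_right this (sub_pos.2 hlt)
        linarith
  · have hc1 : c ≤ 1 := by
      by_contra! h
      have h1 := one_lt_pow₀ h (by lia : n ≠ 0)
      rw [hcn, one_lt_div hm0] at h1
      exact h1.not_gt hgt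
    have hcs : c ^ ((n : ℝ) - s) ≤ 1 :=
      Real.rpow_le_one hc.le hc1 (by linarith [hs.2])
    calc c ^ ((n : ℝ) - s) * e ≤ e := mul_le_of_le_one_left he hcs
      _ < e + Λ * |m - w| := lt_add_of_pos_right _ (by positivity)

lemma penEnergy_eq_genEnergy {n : ℕ} {s ε Λ : ℝ} {F : ℕ → Set (Rn n)}
    (hvol : ∑' k, volume (F k) = volume (ball (0 : Rn n) 1)) :
    penEnergy n s ε Λ F = genEnergy n s ε F := by
  simp [penEnergy, hvol, ennAbsDiff]

lemma exists_energy_unitBall_lt {n : ℕ} (hn : 2 ≤ n) {s : ℝ} (hs : s ∈ Set.Ioo (0 : ℝ) 1) :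
    ∃ C : ℝ, 0 < C ∧ ∀ ε Λ : ℝ, 0 < ε → C * (1 + ε) < Λ →
      energy n s ε (ball (0 : Rn n) 1) < ENNReal.ofReal Λ * volume (ball (0 : Rn n) 1) := by
  obtain ⟨p, hp, hpv⟩ : ∃ p : ℝ, 0 ≤ p ∧ fracPer n s (ball (0 : Rn n) 1) = ENNReal.ofReal p :=
    ⟨_, ENNReal.toReal_nonneg,
      (ENNReal.ofReal_toReal (fracPer_unitBall_lt_top (by lia) hs).ne).symm⟩
  obtain ⟨v, hv, hvv⟩ : ∃ v : ℝ, 0 ≤ v ∧ Vs n s (ball (0 : Rn n) 1) = ENNReal.ofReal v :=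
    ⟨_, ENNReal.toReal_nonneg, (ENNReal.ofReal_toReal (Vs_unitBall_lt_top hn hs).ne).symm⟩
  obtain ⟨w, hw, hwv⟩ : ∃ w : ℝ, 0 < w ∧ volume (ball (0 : Rn n) 1) = ENNReal.ofReal w :=
    ⟨_, ENNReal.toReal_pos (measure_ball_pos _ _ one_pos).ne' measure_ball_lt_top.ne,
      (ENNReal.ofReal_toReal measure_ball_lt_top.ne).symm⟩
  refine ⟨(p + v + 1) / w, by positivity, fun ε Λ hε hΛ => ?_⟩
  have hΛ0 : 0 < Λ := lt_trans (by positivity) hΛ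
  rw [energy, hpv, hvv, hwv, ← ENNReal.ofReal_mul hε.le, ← ENNReal.ofReal_mul hΛ0.le,
    ← ENNReal.ofReal_add hp (by positivity), ENNReal.ofReal_lt_ofReal_iff (by positivity)]
  rw [div_mul_eq_mul_div, div_lt_iff₀ hw] at hΛ
  nlinarith [mul_nonneg hp hε.le]

end Penalization

/-- **Equivalence of the constrained and the penalized generalized problems.** There is a
constant `C_{n,s} > 0` such that for every `ε₀ > 0`, setting `Λ̃ = C_{n,s}(1+ε₀)`, for all
`ε ∈ (0,ε₀)` and all `Λ > Λ̃` the constrained infimum of `Ẽ_s` equals the unconstrained infimum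
of `Ẽ_{s,Λ}`, and any minimizer of the penalized problem satisfies `Σ_k |E^k| = ω_n`. -/
theorem stmt_9 (n : ℕ) (hn : 2 ≤ n) (s : ℝ) (hs : s ∈ Set.Ioo (0 : ℝ) 1) :
    ∃ C : ℝ, 0 < C ∧ ∀ ε₀ : ℝ, 0 < ε₀ → ∀ ε : ℝ, 0 < ε → ε < ε₀ →
      ∀ Λ : ℝ, C * (1 + ε₀) < Λ →
      (sInf {x : ℝ≥0∞ | ∃ F : ℕ → Set (Rn n), (∀ k, MeasurableSet (F k)) ∧
          (∑' k : ℕ, volume (F k)) = volume (ball (0 : Rn n) 1) ∧ x = genEnergy n s ε F} =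
        sInf {x : ℝ≥0∞ | ∃ F : ℕ → Set (Rn n), (∀ k, MeasurableSet (F k)) ∧
          x = penEnergy n s ε Λ F}) ∧
      ∀ F : ℕ → Set (Rn n), (∀ k, MeasurableSet (F k)) →
        (∀ G : ℕ → Set (Rn n), (∀ k, MeasurableSet (G k)) →
          penEnergy n s ε Λ F ≤ penEnergy n s ε Λ G) →
        (∑' k : ℕ, volume (F k)) = volume (ball (0 : Rn n) 1) := by
  obtain ⟨C, hC, hCball⟩ := exists_energy_unitBall_lt hn hs
  refine ⟨C, hC, fun ε₀ hε₀ ε hε hεε₀ Λ hΛ => ?_⟩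
  have hΛ0 : 0 < Λ := lt_trans (by positivity) hΛ
  have hball := hCball ε Λ hε (lt_trans (by gcongr) hΛ)
  refine ⟨le_antisymm (le_sInf ?_) (sInf_le_sInf ?_), fun F hF hmin => ?_⟩
  · rintro _ ⟨F, hF, rfl⟩
    by_cases hvol : ∑' k, volume (F k) = volume (ball (0 : Rn n) 1)
    · exact sInf_le ⟨F, hF, hvol, penEnergy_eq_genEnergy hvol⟩
    · obtain ⟨G, hG, hGvol, hlt⟩ := exists_genEnergy_lt_penEnergy hn hs hΛ0 hball hF hvol
      exact le_trans (sInf_le ⟨G, hG, hGvol, rfl⟩) hlt.le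
  · rintro _ ⟨F, hF, hvol, rfl⟩
    exact ⟨F, hF, (penEnergy_eq_genEnergy hvol).symm⟩
  · by_contra hvol
    obtain ⟨G, hG, hGvol, hlt⟩ := exists_genEnergy_lt_penEnergy hn hs hΛ0 hball hF hvol
    exact (hmin G hG).not_gt ((penEnergy_eq_genEnergy hGvol).trans_lt hlt)
end
end
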